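/- With notation and assumptions as in the context: if μ_{p,1} ≥ μ_{p,r−1} + 2 for some maximal ideal p of A, then Σ_{γ∈R}(E_{k,v+L}|_k γ)(ω) = 0 for every ω ∈ Ω^r. Otherwise, the set S := {p : μ_{p,1} ≥ 2} is finite, there exists v″ ∈ v′ + L′ with v″ ∈ pL′_p for all p ∈ S, and for every such v″ and every ω ∈ Ω^r one has Σ_{γ∈R}(E_{k,v+L}|_k γ)(ω) = Σ_{I ⊆ S} (−1)^{|I|}·E_{k, v″+L′_I}(ω), where L′_I := (∏_{p∈I} p)·L′. (Theorem 14.7.) -/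

import Mathlib

open scoped BigOperators

/-- The pairing of a row vector `x` with a column vector `ω`: `xω = ∑ i, x i * ω i`. -/
noncomputable def rvPair {K : Type*} [Field K] {r : ℕ} (x ω : Fin r → K) : K :=
  ∑ i, x i * ω i

/-- A subset `M` of a seminormed additive group is strongly discrete if `M ∩ B` is finite
for every bounded subset `B`. -/
def StronglyDiscrete {E : Type*} [SeminormedAddCommGroup E] (M : Set E) : Prop :=
  ∀ B : Set E, Bornology.IsBounded B → (M ∩ B).Finite

/-- The coset `v + L`. -/
def cosetOf {G : Type*} [AddGroup G] (v : G) (L : Set G) : Set G := {x | x - v ∈ L}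

/-- The last index of `Fin r`. -/
def lastIdx (r : ℕ) (hr : 0 < r) : Fin r := ⟨r - 1, by omega⟩

/-- The factor of automorphy `j(γ,ω) = ξ⁻¹ · (last entry of γω)`. -/
noncomputable def jfac {K : Type*} [Field K] {r : ℕ} (hr : 0 < r) (ξ : K)
    (γ : Matrix (Fin r) (Fin r) K) (ω : Fin r → K) : K :=
  ξ⁻¹ * (γ.mulVec ω) (lastIdx r hr)

/-- The action `γ(ω) = j(γ,ω)⁻¹ · γω`. -/
noncomputable def actOmega {K : Type*} [Field K] {r : ℕ} (hr : 0 < r) (ξ : K)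
    (γ : Matrix (Fin r) (Fin r) K) (ω : Fin r → K) : Fin r → K :=
  (jfac hr ξ γ ω)⁻¹ • γ.mulVec ω

/-- The Drinfeld period domain `Ω^r`. -/
def OmegaSet {K : Type*} [Field K] (r : ℕ) (hr : 0 < r) (Finf : Subfield K) (ξ : K) :
    Set (Fin r → K) :=
  {ω | (∀ x : Fin r → K, (∀ i, x i ∈ Finf) → rvPair x ω = 0 → x = 0) ∧ ω (lastIdx r hr) = ξ}

/-- The Eisenstein series value `E_k(S)(ω) = ∑_{x ∈ S, x ≠ 0} (σ(x)ω)^{-k}`, where the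
coset `S ⊆ F^r` is embedded into `K^r` via `σ : F →+* K`. -/
noncomputable def EisF {FF K : Type*} [Field FF] [NormedField K] (σ : FF →+* K) {r : ℕ}
    (k : ℕ) (S : Set (Fin r → FF)) (ω : Fin r → K) : K :=
  ∑' x : {x : Fin r → FF // x ∈ S ∧ x ≠ 0}, ((∑ i, σ ((x : Fin r → FF) i) * ω i) ^ k)⁻¹

/-- The localization `M_p = A_p·M` of `M ⊆ F^r` at the prime `p` of `A = 𝔽_q[t]`:
elements of the form `m/s` with `m ∈ M` and `s ∈ A∖p`. -/
def locSet {Fq : Type*} [Field Fq] {r : ℕ} (M : Set (Fin r → RatFunc Fq))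
    (p : Ideal (Polynomial Fq)) : Set (Fin r → RatFunc Fq) :=
  {x | ∃ s : Polynomial Fq, s ∉ p ∧ (fun i => algebraMap (Polynomial Fq) (RatFunc Fq) s * x i) ∈ M}

/-- The image of `γ ∈ GL_r(F)` in `GL_r(K)` (as a matrix), via `σ : F →+* K`. -/
def matOf {FF K : Type*} [Field FF] [Field K] (σ : FF →+* K) {r : ℕ}
    (γ : GL (Fin r) FF) : Matrix (Fin r) (Fin r) K :=
  (γ : Matrix (Fin r) (Fin r) FF).map σ

/-- The stabilizer `Γ_{v+L} = {γ ∈ GL_r(F) : vγ + Lγ = v + L}`. -/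
def GammaSet {FF : Type*} [Field FF] {r : ℕ} (v : Fin r → FF) (L : Set (Fin r → FF)) :
    Set (GL (Fin r) FF) :=
  {γ | (fun x => Matrix.vecMul x (γ : Matrix (Fin r) (Fin r) FF)) '' cosetOf v L =
    cosetOf v L}

/-- The set of `A_p`-linear combinations of the vectors `e j`. -/
def apSpan {Fq : Type*} [Field Fq] {r : ℕ} (p : Ideal (Polynomial Fq))
    (e : Fin r → (Fin r → RatFunc Fq)) : Set (Fin r → RatFunc Fq) :=
  {x | ∃ c : Fin r → RatFunc Fq,
    (∀ j, ∃ a s : Polynomial Fq, s ∉ p ∧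
      c j * algebraMap (Polynomial Fq) (RatFunc Fq) s =
        algebraMap (Polynomial Fq) (RatFunc Fq) a) ∧
    x = ∑ j, (fun i => c j * e j i)}

section LatticeCount

open Module LinearMap

variable {A Λ : Type*} [CommRing A] [AddCommGroup Λ] [Module A Λ]

/-- A family of submodules is stable under transvections if every transvection maps its members
to members. -/
def TransvectionStable (X : Finset (Submodule A Λ)) : Prop :=
  ∀ M ∈ X, ∀ (φ : Dual A Λ) (x : Λ), φ x = 0 → M.map (transvection φ x) ∈ X

lemma map_transvection_eq_self_iff (H : AddSubgroup (Dual A Λ)) {x : Λ}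
    (hH : ∀ φ ∈ H, φ x = 0) (M : Submodule A Λ) :
    (∀ φ ∈ H, M.map (transvection φ x) = M) ↔ ∀ φ ∈ H, ∀ m ∈ M, φ m • x ∈ M := by
  refine ⟨fun h φ hφ m hm => ?_, fun h => ?_⟩
  · have := Submodule.mem_map_of_mem (f := transvection φ x) hm
    rw [h φ hφ, transvection.apply] at this
    exact (M.add_mem_iff_right hm).1 this
  · have key : ∀ φ ∈ H, M.map (transvection φ x) ≤ M := by
      rintro φ hφ _ ⟨m, hm, rfl⟩
      exact M.add_mem hm (h φ hφ m hm)
    refine fun φ hφ => le_antisymm (key φ hφ) fun m hm => ?_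
    refine ⟨transvection (-φ) x m, key (-φ) (H.neg_mem hφ) ⟨m, hm, rfl⟩, ?_⟩
    rw [transvection.comp_of_right_eq_apply (hH φ hφ)]
    simp

open Classical in
/-- A group of transvections with common direction acts on a finite family through a `p`-group, so
the size of the family is congruent to the number of its fixed points. -/
lemma card_modEq_card_filter_fixed {ℓ : ℕ} [Fact ℓ.Prime] [CharP A ℓ] {x : Λ}
    (H : AddSubgroup (Dual A Λ)) (hH : ∀ φ ∈ H, φ x = 0) (Y : Finset (Submodule A Λ))
    (hY : ∀ M ∈ Y, ∀ φ ∈ H, M.map (transvection φ x) ∈ Y) :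
    Y.card ≡ (Y.filter fun M => ∀ φ ∈ H, ∀ m ∈ M, φ m • x ∈ M).card [MOD ℓ] := by
  let act : MulAction (Multiplicative H) Y :=
    { smul := fun φ M => ⟨M.1.map (transvection φ.toAdd.1 x), hY _ M.2 _ φ.toAdd.2⟩
      one_smul := fun M => Subtype.ext <| by
        change M.1.map (transvection 0 x) = M.1
        rw [transvection.of_left_eq_zero, Submodule.map_id]
      mul_smul := fun φ ψ M => Subtype.ext <| by
        change M.1.map (transvection (φ.toAdd.1 + ψ.toAdd.1) x) =
          (M.1.map (transvection ψ.toAdd.1 x)).map (transvection φ.toAdd.1 x)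
        rw [← Submodule.map_comp, transvection.comp_of_right_eq (hH _ φ.toAdd.2)] }
  have hp : IsPGroup ℓ (Multiplicative H) := fun φ => ⟨1, by
    apply Multiplicative.toAdd.injective
    apply Subtype.ext
    ext y
    simp [nsmul_eq_mul]⟩
  have h := hp.card_modEq_card_fixedPoints Y
  rw [Nat.card_eq_fintype_card, Fintype.card_coe] at h
  refine h.trans (congrArg (· % ℓ) ?_)
  rw [← Nat.card_eq_finsetCard]
  refine Nat.card_congr
    { toFun := fun M => ⟨M.1.1, Finset.mem_filter.2 ⟨M.1.2,
        (map_transvection_eq_self_iff H hH _).1 fun φ hφ =>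
          congrArg Subtype.val (M.2 (Multiplicative.ofAdd ⟨φ, hφ⟩))⟩⟩
      invFun := fun M => ⟨⟨M.1, (Finset.mem_filter.1 M.2).1⟩, fun φ => Subtype.ext <|
        (map_transvection_eq_self_iff H hH _).2 (Finset.mem_filter.1 M.2).2 _ φ.toAdd.2⟩
      left_inv := fun _ => rfl
      right_inv := fun _ => rfl }

open Classical in
/-- If every member containing `U` that is fixed by the transvections with direction `x`
preserving `U` contains `c • x`, then `c • x` may be adjoined to `U` without changing the number of
members containing `U`, modulo the characteristic. -/
lemma card_filter_le_modEq_sup {ℓ : ℕ} [Fact ℓ.Prime] [CharP A ℓ] {X : Finset (Submodule A Λ)}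
    (hX : TransvectionStable X) (U : Submodule A Λ) (x : Λ) (c : A)
    (h : ∀ M ∈ X, U ≤ M → (∀ φ : Dual A Λ, φ x = 0 → (∀ u ∈ U, φ u • x ∈ U) →
      ∀ m ∈ M, φ m • x ∈ M) → c • x ∈ M) :
    (X.filter fun M => U ≤ M).card ≡
      (X.filter fun M => U ⊔ Submodule.span A {c • x} ≤ M).card [MOD ℓ] := by
  let H : AddSubgroup (Dual A Λ) :=
    { carrier := {φ | φ x = 0 ∧ ∀ u ∈ U, φ u • x ∈ U}
      zero_mem' := by simp
      add_mem' := fun {φ ψ} hφ hψ => ⟨by simp [hφ.1, hψ.1], fun u hu => by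
        simpa [add_smul] using U.add_mem (hφ.2 u hu) (hψ.2 u hu)⟩
      neg_mem' := fun {φ} hφ => ⟨by simp [hφ.1], fun u hu => by
        simpa using hφ.2 u hu⟩ }
  have hH : ∀ φ ∈ H, φ x = 0 := fun φ hφ => hφ.1
  have stable : ∀ W : Submodule A Λ, (∀ φ ∈ H, ∀ u ∈ W, φ u • x ∈ W) →
      ∀ M ∈ X.filter (fun M => W ≤ M), ∀ φ ∈ H, M.map (transvection φ x) ∈
        X.filter (fun M => W ≤ M) := by
    intro W hW M hM φ hφ
    rw [Finset.mem_filter] at hM ⊢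
    refine ⟨hX M hM.1 φ x hφ.1, ?_⟩
    rw [← (map_transvection_eq_self_iff H hH W).2 hW φ hφ]
    exact Submodule.map_mono hM.2
  have hU' : ∀ φ ∈ H, ∀ u ∈ U ⊔ Submodule.span A {c • x},
      φ u • x ∈ U ⊔ Submodule.span A {c • x} := by
    intro φ hφ y hy
    obtain ⟨u, hu, w, hw, rfl⟩ := Submodule.mem_sup.1 hy
    obtain ⟨a, rfl⟩ := Submodule.mem_span_singleton.1 hw
    simpa [hφ.1] using Submodule.mem_sup_left (hφ.2 u hu)
  refine (card_modEq_card_filter_fixed H hH _ (stable U fun φ hφ => hφ.2)).trans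
    (Nat.ModEq.trans (congrArg (fun Z => Finset.card Z % ℓ) ?_)
      (card_modEq_card_filter_fixed H hH _ (stable _ hU')).symm)
  ext M
  simp only [Finset.mem_filter, sup_le_iff, Submodule.span_singleton_le_iff_mem]
  refine ⟨fun hM => ⟨⟨hM.1.1, hM.1.2, ?_⟩, hM.2⟩, fun hM => ⟨⟨hM.1.1, hM.1.2.1⟩, hM.2⟩⟩
  exact h M hM.1.1 hM.1.2 fun φ h1 h2 => hM.2 φ ⟨h1, h2⟩

end LatticeCount

section PrimeSteps

open Module LinearMap

variable {A Λ : Type*} [CommRing A] [AddCommGroup Λ] [Module A Λ]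

lemma coord_dvd_iff_mem_smul {ι : Type*} [Finite ι] (b : Basis ι A Λ) (π : A) (y : Λ) :
    (∃ y', y = π • y') ↔ ∀ i, π ∣ b.coord i y := by
  refine ⟨?_, fun h => ?_⟩
  · rintro ⟨y', rfl⟩ i
    simp
  · choose d hd using h
    refine ⟨b.equivFun.symm d, b.ext_elem fun i => ?_⟩
    rw [map_smul, Finsupp.smul_apply, smul_eq_mul, ← b.equivFun_apply (b.equivFun.symm d),
      LinearEquiv.apply_symm_apply]
    exact hd i

open Classical in
/-- If the vectors `c • e i` can be adjoined one at a time to the condition `z ∈ M` without changing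
the count, and the final condition is not satisfiable, then the count vanishes. -/
lemma card_filter_mem_modEq_zero_of_step {ℓ : ℕ} {ι : Type*} {X : Finset (Submodule A Λ)} {N c : A}
    (hN : ∀ M ∈ X, ∀ y, N • y ∈ M) (hcN : c ∣ N) (e : ι → Λ) (z : Λ) (J : Finset ι)
    (step : ∀ U : Submodule A Λ, (∀ y, N • y ∈ U) → z ∈ U →
      (∀ u ∈ U, ∃ (y : Λ) (a : A), u = c • y + a • z) → ∀ i ∈ J, (X.filter fun M => U ≤ M).card ≡
        (X.filter fun M => U ⊔ Submodule.span A {c • e i} ≤ M).card [MOD ℓ])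
    (hend : ∀ M ∈ X, z ∈ M → ¬∀ i ∈ J, c • e i ∈ M) :
    (X.filter fun M => z ∈ M).card ≡ 0 [MOD ℓ] := by
  suffices iter : ∀ s ⊆ J, (X.filter fun M => z ∈ M).card ≡ (X.filter fun M =>
      LinearMap.range (lsmul A Λ N) ⊔ Submodule.span A {z} ⊔
        Submodule.span A ((fun i => c • e i) '' s) ≤ M).card [MOD ℓ] by
    refine (iter J subset_rfl).trans (congrArg (· % ℓ) ?_)
    rw [Finset.card_eq_zero, Finset.filter_eq_empty_iff]
    intro M hM h
    simp only [sup_le_iff, Submodule.span_le, Set.singleton_subset_iff, Set.image_subset_iff] at h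
    exact hend M hM h.1.2 fun i hi => h.2 hi
  intro s
  induction s using Finset.induction_on with
  | empty =>
    refine fun _ => congrArg (fun Z => Finset.card Z % ℓ) (Finset.filter_congr fun M hM => ?_)
    simp only [Finset.coe_empty, Set.image_empty, Submodule.span_empty, sup_bot_eq, sup_le_iff,
      Submodule.span_singleton_le_iff_mem]
    refine ⟨fun h => ⟨?_, h⟩, fun h => h.2⟩
    rintro _ ⟨y, rfl⟩
    exact hN M hM y
  | insert i s _ ih =>
    intro hs
    refine (ih ((Finset.subset_insert i s).trans hs)).trans ?_
    have := step (LinearMap.range (lsmul A Λ N) ⊔ Submodule.span A {z} ⊔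
      Submodule.span A ((fun i => c • e i) '' s))
      (fun y => Submodule.mem_sup_left (Submodule.mem_sup_left ⟨y, rfl⟩))
      (Submodule.mem_sup_left (Submodule.mem_sup_right (Submodule.mem_span_singleton_self z)))
      ?_ i (hs (Finset.mem_insert_self i s))
    · rwa [Finset.coe_insert, Set.image_insert_eq, Set.insert_eq, Submodule.span_union,
        sup_comm (Submodule.span A {c • e i}), ← sup_assoc]
    · suffices h : LinearMap.range (lsmul A Λ N) ⊔ Submodule.span A {z} ⊔
          Submodule.span A ((fun i => c • e i) '' s) ≤
            LinearMap.range (lsmul A Λ c) ⊔ Submodule.span A {z} by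
        intro u hu
        obtain ⟨_, ⟨y, rfl⟩, w, hw, rfl⟩ := Submodule.mem_sup.1 (h hu)
        obtain ⟨a, rfl⟩ := Submodule.mem_span_singleton.1 hw
        exact ⟨y, a, rfl⟩
      refine sup_le (sup_le ?_ le_sup_right) (le_sup_of_le_left (Submodule.span_le.2 ?_))
      · refine le_sup_of_le_left ?_
        rintro _ ⟨y, rfl⟩
        obtain ⟨d, rfl⟩ := hcN
        exact ⟨d • y, by simp [smul_smul, mul_comm c d]⟩
      · rintro _ ⟨i, _, rfl⟩
        exact ⟨e i, rfl⟩

lemma mem_of_isCoprime_smul_mem {M : Submodule A Λ} {y : Λ} {a₁ a₂ : A} (h : IsCoprime a₁ a₂)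
    (h₁ : a₁ • y ∈ M) (h₂ : a₂ • y ∈ M) : y ∈ M := by
  obtain ⟨u, w, h⟩ := h
  rw [← one_smul A y, ← h, add_smul, mul_smul, mul_smul]
  exact M.add_mem (M.smul_mem _ h₁) (M.smul_mem _ h₂)

lemma map_eq_of_le_map [IsNoetherian A Λ] (g : Λ ≃ₗ[A] Λ) {P : Submodule A Λ}
    (h : P ≤ P.map (g : Λ →ₗ[A] Λ)) : P.map (g : Λ →ₗ[A] Λ) = P := by
  let F : ℕ → Submodule A Λ := fun n => (Submodule.map (g : Λ →ₗ[A] Λ))^[n] P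
  have hF : ∀ n, F (n + 1) = (F n).map (g : Λ →ₗ[A] Λ) := fun n =>
    Function.iterate_succ_apply' _ _ _
  have hmono : Monotone F := monotone_nat_of_le_succ fun n => by
    induction n with
    | zero => exact h
    | succ n ih => rw [hF n, hF (n + 1)]; exact Submodule.map_mono ih
  obtain ⟨n, hn⟩ := monotone_stabilizes_iff_noetherian.2 ‹_› ⟨F, hmono⟩
  have h1 : F n = F (n + 1) := hn (n + 1) n.le_succ
  have hinj := Submodule.map_injective_of_injective (f := (g : Λ →ₗ[A] Λ)) g.injective
  clear hn
  induction n with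
  | zero => exact h1.symm
  | succ n ih => exact ih (hinj (by rw [← hF, ← hF]; exact h1))

variable [IsDomain A] [IsPrincipalIdealRing A]

lemma mem_of_prime_smul_mem {M : Submodule A Λ} {y : Λ} {π a : A} (hπ : Prime π) (ha : ¬π ∣ a)
    (h1 : π • y ∈ M) (h2 : a • y ∈ M) : y ∈ M :=
  mem_of_isCoprime_smul_mem (hπ.coprime_iff_not_dvd.2 ha) h1 h2

lemma pow_dvd_of_smul_mem {M : Submodule A Λ} {y : Λ} {π N' s : A} {n : ℕ} (hπ : Prime π)
    (h1 : (π ^ (n + 1) * N') • y ∈ M) (h2 : (π ^ n * N') • y ∉ M) (h3 : (N' * s) • y ∈ M) :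
    π ^ (n + 1) ∣ s := by
  by_contra hs
  obtain ⟨a, ha, u, hu, rfl⟩ : ∃ a ≤ n, ∃ u, ¬π ∣ u ∧ s = π ^ a * u := by
    have hs0 : s ≠ 0 := fun h => hs (h ▸ dvd_zero _)
    have hfin : FiniteMultiplicity π s := FiniteMultiplicity.of_prime_left hπ hs0
    obtain ⟨u, hu1, hu2⟩ := hfin.exists_eq_pow_mul_and_not_dvd
    refine ⟨multiplicity π s, ?_, u, hu2, hu1⟩
    by_contra hlt
    refine hs (dvd_trans (pow_dvd_pow π ?_) (Dvd.intro u hu1.symm))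
    omega
  refine h2 (mem_of_prime_smul_mem hπ hu ?_ ?_)
  · rwa [smul_smul, ← mul_assoc, ← pow_succ']
  · have := M.smul_mem (π ^ (n - a)) h3
    rw [smul_smul] at this ⊢
    convert this using 2
    obtain ⟨d, rfl⟩ := Nat.exists_eq_add_of_le ha
    rw [Nat.add_sub_cancel_left]
    ring

open Classical in
/-- If `z ∈ πΛ` and `π` divides the exponent of the quotients at least twice, then the number of
members containing `z` vanishes modulo the characteristic. -/
lemma card_filter_mem_modEq_zero_of_mem_smul {ℓ : ℕ} [Fact ℓ.Prime] [CharP A ℓ] {ι : Type*}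
    [Finite ι] (b : Basis ι A Λ) {X : Finset (Submodule A Λ)} (hX : TransvectionStable X)
    {π c : A} (hπ : Prime π) (hπc : π ∣ c) (hN : ∀ M ∈ X, ∀ y, (π * c) • y ∈ M)
    (hc : ∀ M ∈ X, ∃ y, c • y ∉ M) (hprim : ∀ M ∈ X, ∃ m ∈ M, ¬∃ y, m = π • y)
    (z : Λ) (hz : ∃ y, z = π • y) :
    (X.filter fun M => z ∈ M).card ≡ 0 [MOD ℓ] := by
  have := Fintype.ofFinite ι
  have step : ∀ U : Submodule A Λ, (∀ y, (π * c) • y ∈ U) → (∀ u ∈ U, ∃ y, u = π • y) → ∀ i,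
      (X.filter fun M => U ≤ M).card ≡
        (X.filter fun M => U ⊔ Submodule.span A {c • b i} ≤ M).card [MOD ℓ] := by
    intro U hNU hU i
    refine card_filter_le_modEq_sup hX U (b i) c fun M hM hUM hfix => ?_
    have hcoord : ∀ j ≠ i, ∀ m ∈ M, (c * b.coord j m) • b i ∈ M := by
      intro j hj m hm
      refine hfix (c • b.coord j) ?_ (fun u hu => ?_) m hm
      · simp [Finsupp.single_eq_of_ne hj]
      · obtain ⟨y, rfl⟩ := hU u hu
        have := hNU (b.coord j y • b i)
        rw [smul_smul] at this
        convert this using 2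
        simp only [LinearMap.smul_apply, map_smul, smul_eq_mul]
        ring
    have hNi : π • c • b i ∈ M := by rw [smul_smul]; exact hN M hM _
    by_cases hdvd : ∃ m ∈ M, ∃ j ≠ i, ¬π ∣ b.coord j m
    · obtain ⟨m, hm, j, hj, hd⟩ := hdvd
      refine mem_of_prime_smul_mem hπ hd hNi ?_
      rw [smul_smul, mul_comm]
      exact hcoord j hj m hm
    · push Not at hdvd
      obtain ⟨m, hm, hmπ⟩ := hprim M hM
      have hd : ¬π ∣ b.coord i m := by
        intro hd
        refine hmπ ((coord_dvd_iff_mem_smul b π m).2 fun j => ?_)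
        by_cases hj : j = i
        · exact hj ▸ hd
        · exact hdvd m hm j hj
      refine mem_of_prime_smul_mem hπ hd hNi ?_
      have hsum : c • m = ∑ j, (c * b.coord j m) • b j := by
        conv_lhs => rw [← b.sum_repr m, Finset.smul_sum]
        simp [smul_smul]
      rw [smul_smul, mul_comm]
      have hcm := M.smul_mem c hm
      rw [hsum, ← Finset.add_sum_erase _ _ (Finset.mem_univ i)] at hcm
      refine (M.add_mem_iff_left (M.sum_mem fun j hj => ?_)).1 hcm
      obtain ⟨t, ht⟩ := hdvd m hm j (Finset.ne_of_mem_erase hj)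
      rw [ht]
      have := hN M hM (t • b j)
      rw [smul_smul] at this
      convert this using 2
      ring
  refine card_filter_mem_modEq_zero_of_step hN (dvd_mul_left c π) b z Finset.univ
    (fun U hNU _ hU i _ => step U hNU (fun u hu => ?_) i) fun M hM _ hle => ?_
  · obtain ⟨y, a, rfl⟩ := hU u hu
    obtain ⟨z', rfl⟩ := hz
    obtain ⟨d, rfl⟩ := hπc
    exact ⟨d • y + a • z', by rw [smul_add, smul_comm π a, mul_smul]⟩
  obtain ⟨y, hy⟩ := hc M hM
  apply hy
  rw [← b.sum_repr y, Finset.smul_sum]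
  refine M.sum_mem fun i _ => ?_
  rw [smul_comm]
  exact M.smul_mem _ (hle i (Finset.mem_univ i))

lemma exists_basis_smul_eq {ι : Type*} [Finite ι] (b : Basis ι A Λ) {z : Λ} (hz : z ≠ 0) :
    ∃ (b' : Basis ι A Λ) (i : ι) (d : A), z = d • b' i := by
  obtain ⟨n, S⟩ := Submodule.smithNormalForm b (Submodule.span A {z})
  have hn : n ≤ 1 := by
    have h1 := Module.finrank_eq_card_basis S.bN
    have h2 := finrank_span_le_card (R := A) ({z} : Set Λ)
    simp at h1 h2
    omega
  have hmem : z ∈ Submodule.span A {z} := Submodule.mem_span_singleton_self z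
  have hrep := S.bN.sum_repr ⟨z, hmem⟩
  interval_cases n
  · exact absurd (congrArg Subtype.val hrep).symm (by simpa using hz)
  · refine ⟨S.bM, S.f 0, S.bN.repr ⟨z, hmem⟩ 0 * S.a 0, ?_⟩
    have := congrArg Subtype.val hrep
    rw [mul_smul, ← S.snf]
    simpa using this.symm

open Classical in
/-- If the quotients by the members have, at `π`, largest elementary divisor `π ^ (m + 2)` but two
elementary divisors dividing `π ^ m`, then the number of members containing a given
`z ∉ πΛ` vanishes modulo the characteristic. -/
lemma card_filter_mem_modEq_zero_of_degenerate {ℓ : ℕ} [Fact ℓ.Prime] [CharP A ℓ] {ι : Type*}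
    [Finite ι] (b : Basis ι A Λ) {X : Finset (Submodule A Λ)} (hX : TransvectionStable X)
    {π N' : A} {m : ℕ} (hπ : Prime π) (hN : ∀ M ∈ X, ∀ y, (π ^ (m + 2) * N') • y ∈ M)
    (hc : ∀ M ∈ X, ∃ y, (π ^ (m + 1) * N') • y ∉ M)
    (hdeg : ∀ M ∈ X, ∃ (f₁ f₂ : Λ) (s : A), ¬π ∣ s ∧ s • f₁ ∈ M ∧ (s * π ^ m) • f₂ ∈ M ∧
      ∀ a₁ a₂ : A, (∃ y, a₁ • f₁ + a₂ • f₂ = π • y) → π ∣ a₁ ∧ π ∣ a₂)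
    {z : Λ} (hz : ¬∃ y, z = π • y) :
    (X.filter fun M => z ∈ M).card ≡ 0 [MOD ℓ] := by
  have := Fintype.ofFinite ι
  obtain ⟨b, i₀, d, rfl⟩ := exists_basis_smul_eq b (z := z)
    fun h => hz ⟨0, by rw [h, smul_zero]⟩
  have hd : ¬π ∣ d := by
    rintro ⟨e, rfl⟩
    exact hz ⟨e • b i₀, mul_smul _ _ _⟩
  have hcancel : ∀ {n : ℕ} {s t : A}, ¬π ∣ s → π ^ n ∣ s * t → π ^ n ∣ t := fun hs h =>
    hπ.pow_dvd_of_dvd_mul_left _ hs h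
  refine card_filter_mem_modEq_zero_of_step hN
    (mul_dvd_mul_right (pow_dvd_pow π (Nat.le_succ (m + 1))) N') b _ (Finset.univ.erase i₀)
    (fun U hNU hzU hU j hj => ?_) fun M hM hzM hle => ?_
  · replace hj := Finset.ne_of_mem_erase hj
    refine card_filter_le_modEq_sup hX U (b j) _ fun M hM hUM hfix => ?_
    by_contra hcM
    have key : ∀ a : A, (N' * (π * a)) • b j ∈ M → π ^ (m + 1) ∣ a := by
      intro a ha
      have := pow_dvd_of_smul_mem hπ (hN M hM (b j)) hcM ha
      rw [pow_succ' π (m + 1)] at this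
      exact (mul_dvd_mul_iff_left hπ.ne_zero).1 this
    have h1 : ∀ i, i ≠ i₀ → i ≠ j → ∀ x ∈ M, π ^ (m + 1) ∣ b.coord i x := by
      intro i hi0 hij x hx
      refine key _ ?_
      have := hfix ((π * N') • b.coord i) (by simp [Finsupp.single_eq_of_ne hij]) ?_ x hx
      · convert this using 2
        simp only [LinearMap.smul_apply, smul_eq_mul]
        ring
      · intro u hu
        obtain ⟨y, a, rfl⟩ := hU u hu
        have := hNU ((N' * b.coord i y) • b j)
        rw [smul_smul] at this
        convert this using 2
        simp only [LinearMap.smul_apply, map_smul, map_add, smul_eq_mul, Basis.coord_apply,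
          Basis.repr_self, Finsupp.single_eq_of_ne hi0]
        ring
    have h2 : ∀ i, i ≠ i₀ → ∀ x ∈ M, π ^ (m + 1) ∣ b.coord i x := by
      intro i hi0 x hx
      by_cases hij : i = j
      · subst hij
        refine hcancel hd (key _ ?_)
        have hx' := M.smul_mem (d * (π * N')) hx
        have hsum : (d * (π * N')) • x = ∑ l, (d * (π * N') * b.coord l x) • b l := by
          conv_lhs => rw [← b.sum_repr x, Finset.smul_sum]
          simp [smul_smul]
        rw [hsum, ← Finset.add_sum_erase _ _ (Finset.mem_univ i)] at hx'
        have := (M.add_mem_iff_left (M.sum_mem fun l hl => ?_)).1 hx'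
        · convert this using 2
          ring
        · by_cases hl0 : l = i₀
          · subst hl0
            have := M.smul_mem (π * N' * b.coord l x) (hUM hzU)
            rw [smul_smul] at this
            convert this using 2
            ring
          · obtain ⟨t, ht⟩ := h1 l hl0 (Finset.ne_of_mem_erase hl) x hx
            have := hN M hM ((d * t) • b l)
            rw [smul_smul] at this
            convert this using 2
            rw [ht]
            ring
      · exact h1 i hi0 hij x hx
    obtain ⟨f₁, f₂, s, hs, hf₁, hf₂, hind⟩ := hdeg M hM
    have hf₁' : ∀ i, i ≠ i₀ → π ∣ b.coord i f₁ := fun i hi => by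
      have := h2 i hi _ hf₁
      rw [map_smul, smul_eq_mul] at this
      exact (dvd_pow_self π m.succ_ne_zero).trans (hcancel hs this)
    have hf₂' : ∀ i, i ≠ i₀ → π ∣ b.coord i f₂ := fun i hi => by
      have := h2 i hi _ hf₂
      rw [map_smul, smul_eq_mul, mul_assoc] at this
      have := hcancel hs this
      rw [pow_succ] at this
      exact (mul_dvd_mul_iff_left (pow_ne_zero m hπ.ne_zero)).1 this
    have h3 := hind (b.coord i₀ f₂) (-b.coord i₀ f₁) <| by
      rw [coord_dvd_iff_mem_smul b]
      intro i
      rw [map_add, map_smul, map_smul, smul_eq_mul, smul_eq_mul]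
      by_cases hi : i = i₀
      · subst hi
        exact ⟨0, by ring⟩
      · exact dvd_add ((hf₁' i hi).mul_left _) ((hf₂' i hi).mul_left _)
    have h4 : ∃ y, f₁ = π • y := by
      rw [coord_dvd_iff_mem_smul b]
      intro i
      by_cases hi : i = i₀
      · exact hi ▸ dvd_neg.1 h3.2
      · exact hf₁' i hi
    exact hπ.not_isUnit (isUnit_of_dvd_one (hind 1 0 (by simpa using h4)).1)
  · obtain ⟨y, hy⟩ := hc M hM
    apply hy
    rw [← b.sum_repr y, Finset.smul_sum]
    refine M.sum_mem fun i _ => ?_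
    rw [smul_comm]
    refine M.smul_mem _ ?_
    by_cases hi : i = i₀
    · subst hi
      refine mem_of_prime_smul_mem hπ hd ?_ ?_
      · rw [smul_smul, ← mul_assoc, ← pow_succ']
        exact hN M hM _
      · rw [smul_comm]
        exact M.smul_mem _ hzM
    · exact hle i (Finset.mem_erase.2 ⟨hi, Finset.mem_univ i⟩)

lemma exists_mem_smul_add {ι : Type*} (b : Basis ι A Λ) {X : Finset (Submodule A Λ)}
    (hX : TransvectionStable X) {π N' : A} {n : ℕ} (hπ : Prime π) (hπN' : ¬π ∣ N')
    (hN : ∀ M ∈ X, ∀ y, (π ^ n * N') • y ∈ M) {M : Submodule A Λ} (hM : M ∈ X) {w x : Λ} (i : ι)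
    (hw : ¬π ∣ b.coord i w) (hx : b.coord i x = 0) (hwM : N' • w ∈ M) :
    ∃ M' ∈ X, N' • (w + x) ∈ M' ∧ ∀ (a : A) (y : Λ), π ^ n ∣ a → a • y ∈ M → a • y ∈ M' := by
  obtain ⟨t, u, htu⟩ : IsCoprime (π ^ n) (N' * b.coord i w) :=
    (hπ.coprime_iff_not_dvd.2 fun h => (hπ.dvd_or_dvd h).elim hπN' hw).pow_left
  have hM' := hX M hM ((N' * u) • b.coord i) x
    (by rw [LinearMap.smul_apply, hx, smul_zero])
  refine ⟨_, hM', ?_, fun a y ha hay => ?_⟩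
  · have h1 := Submodule.mem_map_of_mem (f := transvection ((N' * u) • b.coord i) x) hwM
    have h2 := hN _ hM' (t • x)
    convert Submodule.add_mem _ h1 h2 using 1
    rw [transvection.apply, LinearMap.smul_apply, map_smul, smul_eq_mul, smul_eq_mul, smul_add,
      add_assoc, smul_smul _ t, ← add_smul]
    congr 2
    linear_combination -N' * htu
  · have h1 := Submodule.mem_map_of_mem (f := transvection ((N' * u) • b.coord i) x) hay
    obtain ⟨d, rfl⟩ := ha
    have h2 := hN _ hM' ((d * u * b.coord i y) • x)
    convert Submodule.sub_mem _ h1 h2 using 1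
    rw [transvection.apply, LinearMap.smul_apply, map_smul, eq_sub_iff_add_eq]
    simp only [smul_eq_mul]
    module

lemma exists_mem_smul {ι : Type*} [Finite ι] [Nontrivial ι] (b : Basis ι A Λ)
    {X : Finset (Submodule A Λ)} (hX : TransvectionStable X) {π N' : A} {n : ℕ} (hπ : Prime π)
    (hπN' : ¬π ∣ N') (hN : ∀ M ∈ X, ∀ y, (π ^ n * N') • y ∈ M) {M : Submodule A Λ} (hM : M ∈ X)
    {w z : Λ} (hw : ¬∃ y, w = π • y) (hz : ¬∃ y, z = π • y) (hwM : w ∈ M) :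
    ∃ M' ∈ X, N' • z ∈ M' ∧ ∀ (a : A) (y : Λ), π ^ n ∣ a → a • y ∈ M → a • y ∈ M' := by
  have move : ∀ i j, i ≠ j → ∀ (M : Submodule A Λ) (w : Λ), M ∈ X → N' • w ∈ M →
      ¬π ∣ b.coord i w → ¬π ∣ b.coord j z → ∃ M' ∈ X, N' • z ∈ M' ∧
        ∀ (a : A) (y : Λ), π ^ n ∣ a → a • y ∈ M → a • y ∈ M' := by
    intro i j hij M w hM hwM hwi hzj
    obtain ⟨M₁, hM₁, h₁, k₁⟩ := exists_mem_smul_add b hX hπ hπN' hN hM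
      (x := z + (b.coord i w - b.coord i z) • b i - w) i hwi (by simp) hwM
    obtain ⟨M₂, hM₂, h₂, k₂⟩ := exists_mem_smul_add b hX hπ hπN' hN hM₁
      (x := (b.coord i z - b.coord i w) • b i) j
      (by simpa [Finsupp.single_eq_of_ne hij.symm] using hzj)
      (by simp [Finsupp.single_eq_of_ne hij.symm]) h₁
    refine ⟨M₂, hM₂, ?_, fun a y ha h => k₂ a y ha (k₁ a y ha h)⟩
    convert h₂ using 2
    module
  rw [coord_dvd_iff_mem_smul b] at hw hz
  push Not at hw hz
  obtain ⟨i, hi⟩ := hw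
  obtain ⟨j, hj⟩ := hz
  by_cases hij : i = j
  · subst hij
    obtain ⟨l, hl⟩ := exists_ne i
    obtain ⟨M₁, hM₁, h₁, k₁⟩ := exists_mem_smul_add b hX hπ hπN' hN hM
      (x := (1 - b.coord l w) • b l) i hi (by simp [Finsupp.single_eq_of_ne hl.symm])
      (M.smul_mem _ hwM)
    obtain ⟨M₂, hM₂, h₂, k₂⟩ := move l i hl M₁ _ hM₁ h₁
      (by simpa using hπ.not_dvd_one) hj
    exact ⟨M₂, hM₂, h₂, fun a y ha h => k₂ a y ha (k₁ a y ha h)⟩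
  · exact move i j hij M w hM (M.smul_mem _ hwM) hi hj

/-- A transvection-stable family of submodules of bounded exponent covers every vector without local
obstruction. -/
lemma exists_mem_of_forall_prime {ι : Type*} [Finite ι] [Nontrivial ι] (b : Basis ι A Λ)
    {X : Finset (Submodule A Λ)} (hX : TransvectionStable X) (hne : X.Nonempty) {N : A}
    (hN0 : N ≠ 0) (hN : ∀ M ∈ X, ∀ y, N • y ∈ M)
    (hprim : ∀ π, Prime π → π ∣ N → ∀ M ∈ X, ∃ m ∈ M, ¬∃ y, m = π • y) {z : Λ}
    (hz : ∀ π, Prime π → π ^ 2 ∣ N → ¬∃ y, z = π • y) : ∃ M ∈ X, z ∈ M := by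
  suffices h : ∀ g : A, ∀ M ∈ X, g • z ∈ M → g ∣ N → ∃ M ∈ X, z ∈ M by
    obtain ⟨M, hM⟩ := hne
    exact h N M hM (hN M hM z) dvd_rfl
  intro g
  induction g using (wellFounded_dvdNotUnit (α := A)).induction with
  | _ g ih =>
  intro M hM hgM hgN
  have hg0 : g ≠ 0 := fun h => hN0 (zero_dvd_iff.1 (h ▸ hgN))
  by_cases hgu : IsUnit g
  · exact ⟨M, hM, (M.smul_mem_iff_of_isUnit hgu).1 hgM⟩
  obtain ⟨π, hπ, hπg⟩ := WfDvdMonoid.exists_irreducible_factor hgu hg0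
  replace hπ := hπ.prime
  obtain ⟨N', hN', hπN'⟩ :=
    (FiniteMultiplicity.of_prime_left hπ hN0).exists_eq_pow_mul_and_not_dvd
  obtain ⟨g', hg', hπg'⟩ :=
    (FiniteMultiplicity.of_prime_left hπ hg0).exists_eq_pow_mul_and_not_dvd
  generalize multiplicity π N = n at hN'
  generalize multiplicity π g = k at hg'
  obtain ⟨M', hM', h1, h2⟩ : ∃ M' ∈ X, N' • z ∈ M' ∧
      ∀ (a : A) (y : Λ), π ^ n ∣ a → a • y ∈ M → a • y ∈ M' := by
    by_cases hzπ : ∃ y, z = π • y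
    · refine ⟨M, hM, ?_, fun _ _ _ h => h⟩
      obtain ⟨y, rfl⟩ := hzπ
      have hn : n ≤ 1 := by
        by_contra hn
        refine hz π hπ ?_ ⟨y, rfl⟩
        rw [hN']
        exact (pow_dvd_pow π (by omega)).mul_right _
      have := M.smul_mem (π ^ (1 - n)) (hN M hM y)
      rw [smul_smul] at this ⊢
      convert this using 2
      rw [hN', ← mul_assoc, ← pow_add, Nat.sub_add_cancel hn, pow_one, mul_comm]
    · obtain ⟨m, hm, hmπ⟩ := hprim π hπ (hπg.trans hgN) M hM
      exact exists_mem_smul b hX hπ hπN' (hN' ▸ hN) hM hmπ hzπ hm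
  refine ih g' ?_ M' hM' ?_ ?_
  · refine ⟨fun h => hπg' (h ▸ dvd_zero π), π ^ k, ?_, by rw [hg', mul_comm]⟩
    intro hu
    rcases k.eq_zero_or_pos with rfl | hk
    · rw [pow_zero, one_mul] at hg'
      exact hπg' (hg' ▸ hπg)
    · exact hπ.not_isUnit ((isUnit_pow_iff hk.ne').1 hu)
  · obtain ⟨h, rfl⟩ : g' ∣ N' := by
      refine IsCoprime.dvd_of_dvd_mul_left (y := π ^ n)
        (hπ.coprime_iff_not_dvd.2 hπg').symm.pow_right ?_
      rw [← hN']
      exact (Dvd.intro_left _ hg'.symm).trans hgN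
    refine mem_of_isCoprime_smul_mem (a₁ := π ^ (n + k)) (a₂ := h)
      (hπ.coprime_iff_not_dvd.2 fun hd => hπN' (hd.mul_left _)).pow_left ?_ ?_
    · have := h2 (π ^ n * g) z (dvd_mul_right _ _) (by
        rw [mul_smul]; exact M.smul_mem _ hgM)
      rw [smul_smul]
      convert this using 2
      rw [hg']
      ring
    · rwa [smul_smul, mul_comm h]
  · exact (Dvd.intro_left _ hg'.symm).trans hgN

lemma exists_prime_smul_mem {U V : Submodule A Λ} {y : Λ} (hyV : y ∈ V) (hyU : y ∉ U) {d : A}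
    (hd0 : d ≠ 0) (hd : d • y ∈ U) : ∃ π, Prime π ∧ π ∣ d ∧ ∃ y ∈ V, y ∉ U ∧ π • y ∈ U := by
  induction d using UniqueFactorizationMonoid.induction_on_prime with
  | h₁ => exact absurd rfl hd0
  | h₂ d hu => exact absurd ((U.smul_mem_iff_of_isUnit hu).1 hd) hyU
  | h₃ d p hd1 hp ih =>
    by_cases hdy : d • y ∈ U
    · obtain ⟨π, hπ, h, h'⟩ := ih hd1 hdy
      exact ⟨π, hπ, h.mul_left _, h'⟩
    · exact ⟨p, hp, dvd_mul_right _ _, d • y, V.smul_mem _ hyV, hdy, by rwa [smul_smul]⟩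

lemma exists_dual_dvd_and_not_dvd {ι : Type*} [Finite ι] (b : Basis ι A Λ) {π : A} (hπ : Prime π)
    {W : Submodule A Λ} (hW : ∀ y, π • y ∈ W) {l : Λ} (hl : l ∉ W) :
    ∃ ψ : Dual A Λ, (∀ w ∈ W, π ∣ ψ w) ∧ ¬π ∣ ψ l := by
  have := Fintype.ofFinite ι
  obtain ⟨n, S⟩ := Submodule.smithNormalForm b W
  obtain ⟨j, hj⟩ : ∃ j, S.bM.coord j l • S.bM j ∉ W := by
    by_contra! h
    exact hl (S.bM.sum_repr l ▸ W.sum_mem fun j _ => h j)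
  refine ⟨S.bM.coord j, fun w hw => ?_, ?_⟩
  · by_contra hd
    refine hj (W.smul_mem _ (mem_of_prime_smul_mem hπ hd (hW _) ?_))
    by_cases hjf : j ∈ Set.range S.f
    · obtain ⟨i, rfl⟩ := hjf
      have h1 := S.repr_apply_embedding_eq_repr_smul (m := ⟨w, hw⟩) (i := i)
      rw [map_smul, Finsupp.smul_apply, smul_eq_mul] at h1
      rw [Basis.coord_apply, h1, mul_comm, mul_smul, ← S.snf]
      exact W.smul_mem _ (S.bN i).2
    · have h1 := S.repr_eq_zero_of_notMem_range ⟨w, hw⟩ hjf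
      rw [Basis.coord_apply, h1, zero_smul]
      exact W.zero_mem
  · rintro ⟨t, ht⟩
    refine hj ?_
    rw [ht, mul_smul]
    exact hW _

open Classical in
lemma card_filter_le_modEq_sup_of_smul_mem {ℓ : ℕ} [Fact ℓ.Prime] [CharP A ℓ] {ι : Type*}
    [Finite ι] (b : Basis ι A Λ) {X : Finset (Submodule A Λ)} (hX : TransvectionStable X)
    (hiso : ∀ M ∈ X, ∀ M' ∈ X, ∃ g : Λ ≃ₗ[A] Λ, M' = M.map (g : Λ →ₗ[A] Λ))
    {π N' : A} {n : ℕ} (hπ : Prime π) (hπN' : ¬π ∣ N') {U M₁ : Submodule A Λ} (hM₁ : M₁ ∈ X)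
    (hNU : ∀ y, (π ^ (n + 1) * N') • y ∈ U) (hUM₁ : U ≤ M₁) {z : Λ} (hzU : z ∈ U)
    (hz : n ≠ 0 → ¬∃ y, z = π • y)
    (hcyc : ∀ m ∈ M₁, ∃ (s a : A) (l : Λ), ¬π ∣ s ∧ s • m = a • z + π ^ n • l)
    {x : Λ} (hx₁ : (π ^ n * N') • x ∈ M₁) (hxU : (π ^ n * N') • x ∉ U) :
    (X.filter fun M => U ≤ M).card ≡
      (X.filter fun M => U ⊔ Submodule.span A {(π ^ n * N') • x} ≤ M).card [MOD ℓ] := by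
  refine card_filter_le_modEq_sup hX U x _ fun M hM hUM hfix => ?_
  by_contra hxM
  have hπc : ∀ y, π • (π ^ n * N') • y ∈ U := fun y => by
    rw [smul_smul, ← mul_assoc, ← pow_succ']
    exact hNU y
  have hzc : (π ^ n * N') • z ∈ U := U.smul_mem _ hzU
  have hle : M.comap (lsmul A Λ (π ^ n * N')) ≤ M₁.comap (lsmul A Λ (π ^ n * N')) := by
    intro l hl
    by_contra hl₁
    simp only [Submodule.mem_comap, lsmul_apply] at hl hl₁
    obtain ⟨ψ, hψ, hψl⟩ := exists_dual_dvd_and_not_dvd b hπ (l := l)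
      (W := U.comap (lsmul A Λ (π ^ n * N')) ⊔ Submodule.span A {x})
      (fun y => Submodule.mem_sup_left (by
        simp only [Submodule.mem_comap, lsmul_apply]
        rw [smul_comm]
        exact hπc y))
      (fun h => hl₁ <| by
        obtain ⟨u, hu, w, hw, rfl⟩ := Submodule.mem_sup.1 h
        obtain ⟨a, rfl⟩ := Submodule.mem_span_singleton.1 hw
        rw [smul_add, smul_comm _ a]
        exact M₁.add_mem (hUM₁ hu) (M₁.smul_mem _ hx₁))
    have hψU : ∀ u, (π ^ n * N') • u ∈ U → π ∣ ψ u := fun u hu =>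
      hψ u (Submodule.mem_sup_left hu)
    have hψx : π ∣ ψ x := hψ x (Submodule.mem_sup_right (Submodule.mem_span_singleton_self x))
    obtain ⟨χ, hχU, hχx, hχz, hχl⟩ : ∃ χ : Dual A Λ, (∀ u, (π ^ n * N') • u ∈ U → π ∣ χ u) ∧
        χ x = 0 ∧ π ^ (n + 1) ∣ χ z ∧ ¬π ∣ χ l := by
      rcases eq_or_ne n 0 with rfl | hn
      · obtain ⟨i, hi⟩ : ∃ i, ¬π ∣ b.coord i x := by
          by_contra! h
          obtain ⟨y, rfl⟩ := (coord_dvd_iff_mem_smul b π x).2 h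
          exact hxU (by rw [smul_comm]; exact hπc y)
        refine ⟨b.coord i x • ψ - ψ x • b.coord i, fun u hu => ?_, ?_, ?_, fun h => ?_⟩
        · exact dvd_sub ((hψU u hu).mul_left _) (hψx.mul_right _)
        · simp only [LinearMap.sub_apply, LinearMap.smul_apply, smul_eq_mul]
          ring
        · rw [zero_add, pow_one]
          exact dvd_sub ((hψU z hzc).mul_left _) (hψx.mul_right _)
        · exact (hπ.dvd_or_dvd ((dvd_sub_left (hψx.mul_right _)).1 h)).elim hi hψl
      · obtain ⟨j, hj⟩ : ∃ j, ¬π ∣ b.coord j z := by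
          by_contra! h
          exact hz hn ((coord_dvd_iff_mem_smul b π z).2 h)
        obtain ⟨i, hi⟩ : ∃ i, ¬π ∣ b.coord i x * b.coord j z - b.coord j x * b.coord i z := by
          by_contra! h
          obtain ⟨y, hy⟩ := (coord_dvd_iff_mem_smul b π (b.coord j z • x - b.coord j x • z)).2
            fun i => by
              rw [map_sub, map_smul, map_smul, smul_eq_mul, smul_eq_mul, mul_comm]
              exact h i
          refine hxU (mem_of_prime_smul_mem hπ hj (hπc x) ?_)
          rw [smul_comm, eq_add_of_sub_eq hy, smul_add, smul_comm _ π, smul_comm _ (b.coord j x)]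
          exact U.add_mem (hπc y) (U.smul_mem _ hzc)
        have hzψ := hψU z hzc
        refine ⟨(b.coord i x * b.coord j z - b.coord j x * b.coord i z) • ψ -
          (ψ x • (b.coord j z • b.coord i - b.coord i z • b.coord j) +
            ψ z • (b.coord i x • b.coord j - b.coord j x • b.coord i)),
          fun u hu => ?_, ?_, ?_, fun h => ?_⟩
        · exact dvd_sub ((hψU u hu).mul_left _) (dvd_add (hψx.mul_right _) (hzψ.mul_right _))
        · simp only [LinearMap.sub_apply, LinearMap.add_apply, LinearMap.smul_apply, smul_eq_mul]
          ring
        · convert dvd_zero _ using 1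
          simp only [LinearMap.sub_apply, LinearMap.add_apply, LinearMap.smul_apply, smul_eq_mul]
          ring
        · exact (hπ.dvd_or_dvd ((dvd_sub_left
            (dvd_add (hψx.mul_right _) (hzψ.mul_right _))).1 h)).elim hi hψl
    have h1 := hfix (N' • χ) (by rw [LinearMap.smul_apply, hχx, smul_zero]) (fun u hu => ?_) _ hl
    · refine hxM (mem_of_prime_smul_mem hπ (a := N' * χ l)
        (fun h => (hπ.dvd_or_dvd h).elim hπN' hχl) (hUM (hπc x)) ?_)
      rw [smul_smul]
      convert h1 using 2
      simp only [LinearMap.smul_apply, map_smul, smul_eq_mul]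
      ring
    · obtain ⟨s, a, l', hs, h⟩ := hcyc u (hUM₁ hu)
      have hl' : (π ^ n * N') • l' ∈ U := by
        have : (π ^ n * N') • l' = (N' * s) • u - (N' * a) • z := by
          rw [mul_smul N' s, h]
          module
        rw [this]
        exact U.sub_mem (U.smul_mem _ hu) (U.smul_mem _ hzU)
      have hχu : π ^ (n + 1) ∣ χ u := by
        refine hπ.pow_dvd_of_dvd_mul_left _ hs ?_
        rw [← smul_eq_mul, ← map_smul, h, map_add, map_smul, map_smul, smul_eq_mul, smul_eq_mul]
        exact dvd_add (hχz.mul_left _) (by rw [pow_succ]; exact mul_dvd_mul_left _ (hχU _ hl'))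
      obtain ⟨t, ht⟩ := hχu
      have := hNU (t • x)
      rw [smul_smul] at this
      convert this using 2
      rw [LinearMap.smul_apply, ht, smul_eq_mul]
      ring
  have := Module.Finite.of_basis b
  have : IsNoetherian A Λ := isNoetherian_of_isNoetherianRing_of_finite A Λ
  obtain ⟨g, hg⟩ := hiso M hM M₁ hM₁
  have hcomap : M₁.comap (lsmul A Λ (π ^ n * N')) =
      (M.comap (lsmul A Λ (π ^ n * N'))).map (g : Λ →ₗ[A] Λ) := by
    ext y
    simp only [hg, Submodule.mem_comap, lsmul_apply, Submodule.mem_map, LinearEquiv.coe_coe]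
    constructor
    · rintro ⟨m, hm, h⟩
      refine ⟨g.symm y, ?_, g.apply_symm_apply y⟩
      rwa [← map_smul, ← h, g.symm_apply_apply]
    · rintro ⟨m, hm, rfl⟩
      exact ⟨_, hm, map_smul _ _ _⟩
  rw [hcomap] at hle
  have hmem : x ∈ M₁.comap (lsmul A Λ (π ^ n * N')) := hx₁
  rw [hcomap, map_eq_of_le_map g hle] at hmem
  exact hxM hmem

open Classical in
/-- If every member containing `z` is, locally at each prime, generated by `z` up to a multiple of
the exponent one step below the maximal one, then the number of members containing `z` is `1`
modulo the characteristic. -/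
lemma card_filter_mem_modEq_one {ℓ : ℕ} [Fact ℓ.Prime] [CharP A ℓ] {ι : Type*}
    [Finite ι] (b : Basis ι A Λ) {X : Finset (Submodule A Λ)} (hX : TransvectionStable X)
    (hiso : ∀ M ∈ X, ∀ M' ∈ X, ∃ g : Λ ≃ₗ[A] Λ, M' = M.map (g : Λ →ₗ[A] Λ))
    {N : A} (hN0 : N ≠ 0) (hN : ∀ M ∈ X, ∀ y, N • y ∈ M) {z : Λ}
    (hz : ∀ π, Prime π → π ^ 2 ∣ N → ¬∃ y, z = π • y)
    (hcyc : ∀ M ∈ X, z ∈ M → ∀ (π N' : A) (n : ℕ), Prime π → ¬π ∣ N' → N = π ^ (n + 1) * N' →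
      ∀ m ∈ M, ∃ (s a : A) (l : Λ), ¬π ∣ s ∧ s • m = a • z + π ^ n • l)
    (hex : ∃ M ∈ X, z ∈ M) :
    (X.filter fun M => z ∈ M).card ≡ 1 [MOD ℓ] := by
  obtain ⟨M₁, hM₁, hzM₁⟩ := hex
  have := Module.Finite.of_basis b
  have : IsNoetherian A Λ := isNoetherian_of_isNoetherianRing_of_finite A Λ
  suffices h : ∀ U : Submodule A Λ, (∀ y, N • y ∈ U) → z ∈ U → U ≤ M₁ →
      (X.filter fun M => U ≤ M).card ≡ 1 [MOD ℓ] by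
    convert h (LinearMap.range (lsmul A Λ N) ⊔ Submodule.span A {z})
      (fun y => Submodule.mem_sup_left ⟨y, rfl⟩)
      (Submodule.mem_sup_right (Submodule.mem_span_singleton_self z))
      (sup_le ?_ (by simpa using hzM₁)) using 2
    · refine Finset.filter_congr fun M hM => ?_
      rw [sup_le_iff, Submodule.span_singleton_le_iff_mem]
      refine ⟨fun h => ⟨?_, h⟩, fun h => h.2⟩
      rintro _ ⟨y, rfl⟩
      exact hN M hM y
    · rintro _ ⟨y, rfl⟩
      exact hN M₁ hM₁ y
  intro U
  induction U using WellFoundedGT.induction with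
  | _ U ih =>
  intro hNU hzU hUM₁
  by_cases hle : M₁ ≤ U
  · obtain rfl := le_antisymm hUM₁ hle
    refine congrArg (· % ℓ) (Finset.card_eq_one.2 ⟨U, ?_⟩)
    ext M
    rw [Finset.mem_filter, Finset.mem_singleton]
    refine ⟨fun h => ?_, fun h => by rw [h]; exact ⟨hM₁, le_rfl⟩⟩
    obtain ⟨g, hg⟩ := hiso U hM₁ M h.1
    rw [hg] at h ⊢
    exact map_eq_of_le_map g h.2
  · obtain ⟨y, hyM₁, hyU⟩ := Set.not_subset.1 hle
    obtain ⟨π, hπ, hπN, y₁, hy₁, hy₁U, hπy₁⟩ := exists_prime_smul_mem hyM₁ hyU hN0 (hNU y)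
    obtain ⟨n, N', hπN', rfl⟩ : ∃ n N', ¬π ∣ N' ∧ N = π ^ (n + 1) * N' := by
      obtain ⟨N', hN', h⟩ :=
        (FiniteMultiplicity.of_prime_left hπ hN0).exists_eq_pow_mul_and_not_dvd
      generalize multiplicity π N = n at hN'
      cases n with
      | zero => exact absurd (by rw [pow_zero, one_mul] at hN'; rwa [hN'] at hπN) h
      | succ n => exact ⟨n, N', h, hN'⟩
    have hcyc₁ := hcyc M₁ hM₁ hzM₁ π N' n hπ hπN' rfl
    obtain ⟨s, a, x, hs, hx⟩ := hcyc₁ y₁ hy₁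
    have hcx : (π ^ n * N') • x = (N' * s) • y₁ - (N' * a) • z := by
      rw [mul_smul N' s, hx]
      module
    have hx₁ : (π ^ n * N') • x ∈ M₁ := by
      rw [hcx]
      exact M₁.sub_mem (M₁.smul_mem _ hy₁) (M₁.smul_mem _ hzM₁)
    have hxU : (π ^ n * N') • x ∉ U := by
      rw [hcx, U.sub_mem_iff_left (U.smul_mem _ hzU)]
      exact fun h => hy₁U
        (mem_of_prime_smul_mem hπ (fun h => (hπ.dvd_or_dvd h).elim hπN' hs) hπy₁ h)
    refine (card_filter_le_modEq_sup_of_smul_mem b hX hiso hπ hπN' hM₁ hNU hUM₁ hzU (fun hn =>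
      hz π hπ ((pow_dvd_pow π (by omega)).mul_right _)) hcyc₁ hx₁ hxU).trans
      (ih _ ?_ (fun y => Submodule.mem_sup_left (hNU y)) (Submodule.mem_sup_left hzU)
        (sup_le hUM₁ (by simpa using hx₁)))
    refine lt_of_le_of_ne le_sup_left fun h => hxU ?_
    rw [h]
    exact Submodule.mem_sup_right (Submodule.mem_span_singleton_self _)

end PrimeSteps

section Adapted

open Module LinearMap

variable {A Λ : Type*} [CommRing A] [AddCommGroup Λ] [Module A Λ]

/-- After localization at `π`, the vectors `e j` form a basis of `Λ` and the multiples
`π ^ μ j • e j` form a basis of `M`. -/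
structure IsAdapted (π : A) (M : Submodule A Λ) {r : ℕ} (μ : Fin r → ℕ) (e : Fin r → Λ) :
    Prop where
  linearIndependent : LinearIndependent A e
  exists_smul_eq (y : Λ) : ∃ (s : A) (c : Fin r → A), ¬π ∣ s ∧ s • y = ∑ j, c j • e j
  exists_smul_eq_of_mem (y : Λ) (hy : y ∈ M) : ∃ (s : A) (c : Fin r → A), ¬π ∣ s ∧
    s • y = ∑ j, (c j * π ^ μ j) • e j
  exists_smul_mem (j : Fin r) : ∃ s : A, ¬π ∣ s ∧ (s * π ^ μ j) • e j ∈ M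

namespace IsAdapted

variable {π : A} {M : Submodule A Λ} {r : ℕ} {μ : Fin r → ℕ} {e : Fin r → Λ}

lemma map (h : IsAdapted π M μ e) (g : Λ ≃ₗ[A] Λ) :
    IsAdapted π (M.map (g : Λ →ₗ[A] Λ)) μ (g ∘ e) where
  linearIndependent := h.linearIndependent.map' (g : Λ →ₗ[A] Λ) g.ker
  exists_smul_eq y := by
    obtain ⟨s, c, hs, hsc⟩ := h.exists_smul_eq (g.symm y)
    refine ⟨s, c, hs, ?_⟩
    have := congrArg g hsc
    simpa using this
  exists_smul_eq_of_mem := by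
    rintro _ ⟨y, hy, rfl⟩
    obtain ⟨s, c, hs, hsc⟩ := h.exists_smul_eq_of_mem y hy
    refine ⟨s, c, hs, ?_⟩
    have := congrArg g hsc
    simpa using this
  exists_smul_mem j := by
    obtain ⟨s, hs, hsj⟩ := h.exists_smul_mem j
    exact ⟨s, hs, _, hsj, map_smul _ _ _⟩

lemma of_associated (h : IsAdapted π M μ e) {π' : A} (hπ : Associated π π') :
    IsAdapted π' M μ e where
  linearIndependent := h.linearIndependent
  exists_smul_eq y := by simpa only [hπ.dvd_iff_dvd_left] using h.exists_smul_eq y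
  exists_smul_eq_of_mem y hy := by
    obtain ⟨u, rfl⟩ := hπ.symm
    obtain ⟨s, c, hs, hsc⟩ := h.exists_smul_eq_of_mem y hy
    refine ⟨s, fun j => c j * u ^ μ j, fun hd => hs ((Units.mul_right_dvd).2 hd), ?_⟩
    simpa only [mul_pow, mul_assoc, mul_left_comm, mul_comm] using hsc
  exists_smul_mem j := by
    obtain ⟨u, rfl⟩ := hπ
    obtain ⟨s, hs, hsj⟩ := h.exists_smul_mem j
    refine ⟨s, fun hd => hs ((Units.mul_right_dvd).1 hd), ?_⟩
    rw [mul_pow, ← mul_assoc, mul_comm, mul_smul]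
    exact M.smul_mem _ hsj

lemma dvd_of_sum_smul_eq (h : IsAdapted π M μ e) (hπ : Prime π) {c : Fin r → A} {y : Λ}
    (hc : ∑ j, c j • e j = π • y) (j : Fin r) : π ∣ c j := by
  obtain ⟨s, d, hs, hsd⟩ := h.exists_smul_eq y
  have h1 : ∑ j, (s * c j - π * d j) • e j = 0 := by
    simp only [sub_smul, mul_smul, Finset.sum_sub_distrib, ← Finset.smul_sum, hc, ← hsd]
    rw [smul_comm, sub_self]
  have h2 := Fintype.linearIndependent_iff.1 h.linearIndependent _ h1 j
  exact (hπ.dvd_or_dvd (Dvd.intro _ (sub_eq_zero.1 h2).symm)).resolve_left hs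

lemma dvd_of_smul_eq (h : IsAdapted π M μ e) (hπ : Prime π) {a : A} {j : Fin r} {y : Λ}
    (ha : a • e j = π • y) : π ∣ a := by
  classical
  have := h.dvd_of_sum_smul_eq hπ (c := Pi.single j a) (y := y)
    (by simpa [Pi.single_apply, ite_smul] using ha) j
  simpa using this

lemma exists_mul_pow_smul_mem (h : IsAdapted π M μ e) (hπ : Prime π) {n : ℕ}
    (hn : ∀ j, μ j ≤ n) (y : Λ) : ∃ s : A, ¬π ∣ s ∧ (s * π ^ n) • y ∈ M := by
  obtain ⟨s, c, hs, hsc⟩ := h.exists_smul_eq y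
  choose t ht htM using h.exists_smul_mem
  refine ⟨(∏ j, t j) * s, fun hd => ?_, ?_⟩
  · rcases hπ.dvd_or_dvd hd with hd | hd
    · obtain ⟨j, -, hj⟩ := hπ.exists_mem_finset_dvd hd
      exact ht j hj
    · exact hs hd
  · have : ((∏ j, t j) * s * π ^ n) • y = ((∏ j, t j) * π ^ n) • s • y := by
      rw [smul_smul]; congr 1; ring
    rw [this, hsc, Finset.smul_sum]
    refine M.sum_mem fun j _ => ?_
    obtain ⟨d, hd⟩ : t j * π ^ μ j ∣ (∏ j, t j) * π ^ n :=
      mul_dvd_mul (Finset.dvd_prod_of_mem t (Finset.mem_univ j)) (pow_dvd_pow π (hn j))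
    rw [hd, smul_comm, mul_comm (t j * _), mul_smul]
    exact M.smul_mem _ (M.smul_mem _ (htM j))

lemma exists_mul_pow_forall_smul_mem [Module.Finite A Λ] (h : IsAdapted π M μ e) (hπ : Prime π)
    {n : ℕ} (hn : ∀ j, μ j ≤ n) : ∃ s : A, ¬π ∣ s ∧ ∀ y, (s * π ^ n) • y ∈ M := by
  choose s hs hsM using h.exists_mul_pow_smul_mem hπ hn
  obtain ⟨T, hT⟩ := (Module.finite_def.1 ‹Module.Finite A Λ› : (⊤ : Submodule A Λ).FG)
  refine ⟨∏ y ∈ T, s y, fun hd => ?_, fun y => ?_⟩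
  · obtain ⟨y, -, hy⟩ := hπ.exists_mem_finset_dvd hd
    exact hs y hy
  · have hle : (⊤ : Submodule A Λ) ≤ M.comap (lsmul A Λ ((∏ y ∈ T, s y) * π ^ n)) := by
      rw [← hT, Submodule.span_le]
      intro y hy
      obtain ⟨d, hd⟩ := Finset.dvd_prod_of_mem s hy
      change ((∏ y ∈ T, s y) * π ^ n) • y ∈ M
      rw [hd, mul_right_comm, mul_comm, mul_smul]
      exact M.smul_mem _ (hsM y)
    exact hle (Submodule.mem_top (x := y))

lemma exists_not_mem_smul (h : IsAdapted π M μ e) (hπ : Prime π) {j : Fin r} (hj : μ j = 0) :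
    ∃ m ∈ M, ¬∃ y, m = π • y := by
  obtain ⟨s, hs, hsM⟩ := h.exists_smul_mem j
  rw [hj, pow_zero, mul_one] at hsM
  exact ⟨_, hsM, fun ⟨y, hy⟩ => hs (h.dvd_of_smul_eq hπ hy)⟩

lemma exists_pair (h : IsAdapted π M μ e) (hπ : Prime π) {i j : Fin r} (hij : i ≠ j)
    (hi : μ i = 0) {m : ℕ} (hj : μ j ≤ m) :
    ∃ (f₁ f₂ : Λ) (s : A), ¬π ∣ s ∧ s • f₁ ∈ M ∧ (s * π ^ m) • f₂ ∈ M ∧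
      ∀ a₁ a₂ : A, (∃ y, a₁ • f₁ + a₂ • f₂ = π • y) → π ∣ a₁ ∧ π ∣ a₂ := by
  classical
  obtain ⟨s, hs, hsM⟩ := h.exists_smul_mem i
  obtain ⟨t, ht, htM⟩ := h.exists_smul_mem j
  rw [hi, pow_zero, mul_one] at hsM
  refine ⟨e i, e j, s * t, fun hd => (hπ.dvd_or_dvd hd).elim hs ht, ?_, ?_, ?_⟩
  · rw [mul_comm, mul_smul]
    exact M.smul_mem _ hsM
  · obtain ⟨d, rfl⟩ := Nat.exists_eq_add_of_le hj
    have : s * t * π ^ (μ j + d) = (s * π ^ d) * (t * π ^ μ j) := by ring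
    rw [this, mul_smul]
    exact M.smul_mem _ htM
  · rintro a₁ a₂ ⟨y, hy⟩
    have key := h.dvd_of_sum_smul_eq hπ (c := Pi.single i a₁ + Pi.single j a₂) (y := y) (by
      simpa [Pi.single_apply, ite_smul, add_smul, Finset.sum_add_distrib] using hy)
    have h1 := key i
    have h2 := key j
    simp only [Pi.add_apply, Pi.single_eq_same, Pi.single_eq_of_ne hij, Pi.single_eq_of_ne hij.symm,
      add_zero, zero_add] at h1 h2
    exact ⟨h1, h2⟩

variable [IsDomain A]

lemma pow_dvd_of_smul_mem (h : IsAdapted π M μ e) (hπ : Prime π) {a : A} {j : Fin r}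
    (ha : a • e j ∈ M) : π ^ μ j ∣ a := by
  classical
  obtain ⟨s, c, hs, hsc⟩ := h.exists_smul_eq_of_mem _ ha
  have h1 : ∑ i, (s * (Pi.single j a : Fin r → A) i - c i * π ^ μ i) • e i = 0 := by
    rw [smul_smul] at hsc
    simp only [sub_smul, Finset.sum_sub_distrib, ← hsc]
    simp [Pi.single_apply, ite_smul]
  have h2 := Fintype.linearIndependent_iff.1 h.linearIndependent _ h1 j
  rw [Pi.single_eq_same, sub_eq_zero, mul_comm (c j)] at h2
  exact hπ.pow_dvd_of_dvd_mul_left _ hs (Dvd.intro _ h2.symm)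

lemma eq_of_forall_smul_mem_iff [Module.Finite A Λ] (h : IsAdapted π M μ e) (hπ : Prime π)
    {N N' : A} (hN : ∀ a : A, (∀ y, a • y ∈ M) ↔ N ∣ a) {m : ℕ} (hN' : N = π ^ m * N')
    (hπN' : ¬π ∣ N') {i : Fin r} (hi : ∀ j, μ j ≤ μ i) : μ i = m := by
  refine le_antisymm ?_ ?_
  · by_contra! hlt
    have h1 := h.pow_dvd_of_smul_mem hπ ((hN N).2 dvd_rfl (e i))
    obtain ⟨d, hd⟩ := Nat.exists_eq_add_of_lt hlt
    rw [hN', hd, add_assoc, pow_add, mul_dvd_mul_iff_left (pow_ne_zero _ hπ.ne_zero),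
      pow_succ'] at h1
    exact hπN' ((dvd_mul_right _ _).trans h1)
  · obtain ⟨s, hs, hsM⟩ := h.exists_mul_pow_forall_smul_mem hπ hi
    by_contra! hlt
    have h1 := (hN _).1 hsM
    obtain ⟨d, hd⟩ := Nat.exists_eq_add_of_lt hlt
    rw [hN', hd, add_assoc, pow_add, mul_comm s, mul_assoc,
      mul_dvd_mul_iff_left (pow_ne_zero _ hπ.ne_zero), pow_succ', mul_assoc] at h1
    exact hs ((dvd_mul_right _ _).trans h1)

lemma exists_smul_eq_smul_add [IsPrincipalIdealRing A] (h : IsAdapted π M μ e) (hπ : Prime π)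
    {i : Fin r} {n : ℕ} (hn : ∀ j, j ≠ i → n ≤ μ j) (hi : μ i = 0) {z : Λ} (hzM : z ∈ M)
    (hz : n ≠ 0 → ¬∃ y, z = π • y) {m : Λ} (hm : m ∈ M) :
    ∃ (s a : A) (l : Λ), ¬π ∣ s ∧ s • m = a • z + π ^ n • l := by
  rcases eq_or_ne n 0 with rfl | hn0
  · exact ⟨1, 0, m, hπ.not_dvd_one, by simp⟩
  have key : ∀ y ∈ M, ∃ (s c : A) (l : Λ), ¬π ∣ s ∧ s • y = c • e i + π ^ n • l := by
    intro y hy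
    obtain ⟨s, c, hs, hsc⟩ := h.exists_smul_eq_of_mem y hy
    refine ⟨s, c i, ∑ j ∈ Finset.univ.erase i, (c j * π ^ (μ j - n)) • e j, hs, ?_⟩
    rw [hsc, ← Finset.add_sum_erase _ _ (Finset.mem_univ i), hi, pow_zero, mul_one,
      Finset.smul_sum]
    congr 1
    refine Finset.sum_congr rfl fun j hj => ?_
    rw [smul_smul, mul_left_comm, ← pow_add, Nat.add_sub_cancel' (hn j (Finset.ne_of_mem_erase hj))]
  obtain ⟨s, c, l, hs, hsc⟩ := key z hzM
  obtain ⟨t, d, l', ht, htd⟩ := key m hm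
  have hc : ¬π ∣ c := by
    rintro ⟨c, rfl⟩
    have h1 : z ∈ LinearMap.range (lsmul A Λ π) := by
      refine mem_of_prime_smul_mem hπ hs ⟨z, rfl⟩ ⟨c • e i + π ^ (n - 1) • l, ?_⟩
      rw [hsc, lsmul_apply, smul_add, smul_smul, smul_smul, ← pow_succ',
        Nat.sub_add_cancel (Nat.one_le_iff_ne_zero.2 hn0)]
    obtain ⟨y, hy⟩ := h1
    exact hz hn0 ⟨y, hy.symm⟩
  refine ⟨c * t, d * s, c • l' - d • l, fun hd => (hπ.dvd_or_dvd hd).elim hc ht, ?_⟩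
  rw [mul_smul, htd, mul_smul, hsc]
  module

end IsAdapted

variable [IsDomain A]

lemma exists_smul_notMem {X : Finset (Submodule A Λ)} {N π c : A} (hN0 : N ≠ 0)
    (hN : ∀ M ∈ X, ∀ a : A, (∀ y, a • y ∈ M) ↔ N ∣ a) (hπ : Prime π) (hc : N = π * c) :
    ∀ M ∈ X, ∃ y, c • y ∉ M := by
  intro M hM
  by_contra! h
  have h1 := (hN M hM c).1 h
  rw [hc] at h1 hN0
  have h2 : π * c ∣ 1 * c := by rwa [one_mul]
  exact hπ.not_isUnit (isUnit_of_dvd_one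
    ((mul_dvd_mul_iff_right (right_ne_zero_of_mul hN0)).1 h2))

variable [IsPrincipalIdealRing A]

open Classical in
lemma card_filter_mem_modEq_zero_of_sq_dvd {ℓ : ℕ} [Fact ℓ.Prime] [CharP A ℓ] {ι : Type*}
    [Finite ι] (b : Basis ι A Λ) {X : Finset (Submodule A Λ)} (hX : TransvectionStable X)
    {N : A} (hN0 : N ≠ 0) (hN : ∀ M ∈ X, ∀ a : A, (∀ y, a • y ∈ M) ↔ N ∣ a)
    {π : A} (hπ : Prime π) (hπN : π ^ 2 ∣ N) {r : ℕ} {μ : Fin r → ℕ} {i : Fin r} (hi : μ i = 0)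
    (had : ∀ M ∈ X, ∃ e : Fin r → Λ, IsAdapted π M μ e) {z : Λ} (hz : ∃ y, z = π • y) :
    (X.filter fun M => z ∈ M).card ≡ 0 [MOD ℓ] := by
  obtain ⟨d, hd⟩ := hπN
  rw [pow_two, mul_assoc] at hd
  refine card_filter_mem_modEq_zero_of_mem_smul b hX hπ (Dvd.intro d rfl)
    (fun M hM => (hN M hM _).2 (hd ▸ dvd_rfl)) (exists_smul_notMem hN0 hN hπ hd)
    (fun M hM => ?_) z hz
  obtain ⟨e, he⟩ := had M hM
  exact he.exists_not_mem_smul hπ hi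

open Classical in
lemma card_filter_mem_modEq_zero_of_add_two_le {ℓ : ℕ} [Fact ℓ.Prime] [CharP A ℓ] {ι : Type*}
    [Finite ι] (b : Basis ι A Λ) {X : Finset (Submodule A Λ)} (hX : TransvectionStable X)
    {N : A} (hN0 : N ≠ 0) (hN : ∀ M ∈ X, ∀ a : A, (∀ y, a • y ∈ M) ↔ N ∣ a)
    {π : A} (hπ : Prime π) {r : ℕ} {μ : Fin r → ℕ} {i j l : Fin r} (hi : μ i = 0)
    (hl : ∀ j, μ j ≤ μ l) (hij : i ≠ j) (hjl : μ j + 2 ≤ μ l)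
    (had : ∀ M ∈ X, ∃ e : Fin r → Λ, IsAdapted π M μ e) (z : Λ) :
    (X.filter fun M => z ∈ M).card ≡ 0 [MOD ℓ] := by
  have := Module.Finite.of_basis b
  rcases X.eq_empty_or_nonempty with rfl | ⟨M₀, hM₀⟩
  · rfl
  obtain ⟨N', hN', hπN'⟩ :=
    (FiniteMultiplicity.of_prime_left hπ hN0).exists_eq_pow_mul_and_not_dvd
  obtain ⟨e₀, he₀⟩ := had M₀ hM₀
  rw [← he₀.eq_of_forall_smul_mem_iff hπ (hN M₀ hM₀) hN' hπN' hl] at hN'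
  obtain ⟨m, hm⟩ := Nat.exists_eq_add_of_le' ((Nat.le_add_left 2 _).trans hjl)
  rw [hm] at hN'
  by_cases hz : ∃ y, z = π • y
  · exact card_filter_mem_modEq_zero_of_sq_dvd b hX hN0 hN hπ
      (hN' ▸ (pow_dvd_pow π (Nat.le_add_left 2 m)).mul_right _) hi had hz
  · refine card_filter_mem_modEq_zero_of_degenerate b hX hπ
      (N' := N') (m := m)
      (fun M hM => (hN M hM _).2 (by rw [hN']))
      (exists_smul_notMem hN0 hN hπ (by rw [hN']; ring)) (fun M hM => ?_) hz
    obtain ⟨e, he⟩ := had M hM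
    exact he.exists_pair hπ hij hi (by omega)

open Classical in
lemma card_filter_mem_modEq_one_of_le_add_one {ℓ : ℕ} [Fact ℓ.Prime] [CharP A ℓ] {ι : Type*}
    [Finite ι] [Nontrivial ι] (b : Basis ι A Λ) {X : Finset (Submodule A Λ)}
    (hX : TransvectionStable X) (hne : X.Nonempty)
    (hiso : ∀ M ∈ X, ∀ M' ∈ X, ∃ g : Λ ≃ₗ[A] Λ, M' = M.map (g : Λ →ₗ[A] Λ))
    {N : A} (hN0 : N ≠ 0) (hN : ∀ M ∈ X, ∀ a : A, (∀ y, a • y ∈ M) ↔ N ∣ a) {r : ℕ} {i l : Fin r}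
    (had : ∀ π, Prime π → ∃ μ : Fin r → ℕ, μ i = 0 ∧ (∀ j, μ j ≤ μ l) ∧
      (∀ j, j ≠ i → μ l ≤ μ j + 1) ∧ ∀ M ∈ X, ∃ e : Fin r → Λ, IsAdapted π M μ e) {z : Λ}
    (hz : ∀ π, Prime π → π ^ 2 ∣ N → ¬∃ y, z = π • y) :
    (X.filter fun M => z ∈ M).card ≡ 1 [MOD ℓ] := by
  have := Module.Finite.of_basis b
  refine card_filter_mem_modEq_one b hX hiso hN0 (fun M hM => (hN M hM N).2 dvd_rfl) hz
    (fun M hM hzM π N' n hπ hπN' hN' m hm => ?_)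
    (exists_mem_of_forall_prime b hX hne hN0 (fun M hM => (hN M hM N).2 dvd_rfl)
      (fun π hπ _ M hM => ?_) hz)
  · obtain ⟨μ, hi, hl, hμ, had⟩ := had π hπ
    obtain ⟨e, he⟩ := had M hM
    have hμl := he.eq_of_forall_smul_mem_iff hπ (hN M hM) hN' hπN' hl
    refine he.exists_smul_eq_smul_add hπ (fun j hj => ?_) hi hzM (fun hn => ?_) hm
    · have := hμ j hj
      omega
    · exact hz π hπ (hN' ▸ (pow_dvd_pow π (by omega)).mul_right _)
  · obtain ⟨μ, hi, -, -, had⟩ := had π hπ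
    obtain ⟨e, he⟩ := had M hM
    exact he.exists_not_mem_smul hπ hi

end Adapted

section RowAction

open Module

variable {A F : Type*} [CommRing A] [Field F] [Algebra A F] {r : ℕ}

/-- The right action `x ↦ xγ` of `GL_r(F)` on row vectors, as an automorphism over a base ring. -/
def rowAct (A : Type*) {F : Type*} [CommRing A] [Field F] [Algebra A F] {r : ℕ}
    (γ : GL (Fin r) F) : (Fin r → F) ≃ₗ[A] (Fin r → F) where
  toFun x := Matrix.vecMul x (γ : Matrix (Fin r) (Fin r) F)
  map_add' x y := Matrix.add_vecMul _ x y
  map_smul' a x := Matrix.smul_vecMul a x _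
  invFun x := Matrix.vecMul x ((γ⁻¹ : GL (Fin r) F) : Matrix (Fin r) (Fin r) F)
  left_inv x := by simp [Matrix.vecMul_vecMul]
  right_inv x := by simp [Matrix.vecMul_vecMul]

lemma rowAct_apply (γ : GL (Fin r) F) (x : Fin r → F) :
    rowAct A γ x = Matrix.vecMul x (γ : Matrix (Fin r) (Fin r) F) := rfl

lemma rowAct_mul_apply (γ γ' : GL (Fin r) F) (x : Fin r → F) :
    rowAct A (γ * γ') x = rowAct A γ' (rowAct A γ x) := by
  simp [rowAct_apply, Matrix.vecMul_vecMul]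

lemma map_rowAct_mul (γ γ' : GL (Fin r) F) (L : Submodule A (Fin r → F)) :
    L.map (rowAct A (γ * γ') : (Fin r → F) →ₗ[A] (Fin r → F)) =
      (L.map (rowAct A γ : (Fin r → F) →ₗ[A] (Fin r → F))).map
        (rowAct A γ' : (Fin r → F) →ₗ[A] (Fin r → F)) := by
  rw [← Submodule.map_comp]
  congr 1
  exact LinearMap.ext fun x => rowAct_mul_apply γ γ' x

lemma mem_cosetOf {G : Type*} [AddGroup G] {v x : G} {L : Set G} :
    x ∈ cosetOf v L ↔ x - v ∈ L := Iff.rfl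

lemma image_cosetOf (γ : GL (Fin r) F) (v : Fin r → F) (L : Submodule A (Fin r → F)) :
    (fun x => Matrix.vecMul x (γ : Matrix (Fin r) (Fin r) F)) '' cosetOf v L =
      cosetOf (rowAct A γ v)
        (L.map (rowAct A γ : (Fin r → F) →ₗ[A] (Fin r → F)) : Submodule A (Fin r → F)) := by
  ext x
  constructor
  · rintro ⟨y, hy, rfl⟩
    exact ⟨y - v, hy, map_sub (rowAct A γ) y v⟩
  · rintro ⟨y, hy, h⟩
    refine ⟨y + v, by simpa [mem_cosetOf] using hy, ?_⟩
    change rowAct A γ (y + v) = x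
    rw [map_add]
    exact add_eq_of_eq_sub h

lemma cosetOf_subset_iff {v v' : Fin r → F} {L L' : Submodule A (Fin r → F)} :
    cosetOf v (L : Set (Fin r → F)) ⊆ cosetOf v' L' ↔ v - v' ∈ L' ∧ L ≤ L' := by
  refine ⟨fun h => ?_, fun h x hx => ?_⟩
  · have hv : v - v' ∈ L' := h (by simp [mem_cosetOf])
    refine ⟨hv, fun x hx => ?_⟩
    have := L'.sub_mem (h (a := x + v) (by simpa [mem_cosetOf] using hx)) hv
    simpa using this
  · have := L'.add_mem (h.2 hx) h.1
    simpa [mem_cosetOf] using this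

lemma cosetOf_eq_iff {v v' : Fin r → F} {L L' : Submodule A (Fin r → F)} :
    cosetOf v (L : Set (Fin r → F)) = cosetOf v' L' ↔ v - v' ∈ L' ∧ L = L' := by
  rw [Set.Subset.antisymm_iff, cosetOf_subset_iff, cosetOf_subset_iff]
  refine ⟨fun h => ⟨h.1.1, le_antisymm h.1.2 h.2.2⟩, ?_⟩
  rintro ⟨h, rfl⟩
  exact ⟨⟨h, le_rfl⟩, by rw [← neg_sub]; exact L.neg_mem h, le_rfl⟩

lemma mem_GammaSet_iff {γ : GL (Fin r) F} {v : Fin r → F} {L : Submodule A (Fin r → F)} :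
    γ ∈ GammaSet v (L : Set (Fin r → F)) ↔ rowAct A γ v - v ∈ L ∧
      L.map (rowAct A γ : (Fin r → F) →ₗ[A] (Fin r → F)) = L := by
  rw [GammaSet, Set.mem_ofPred_eq, image_cosetOf, cosetOf_eq_iff]

lemma mem_GammaSet_iff_image {γ : GL (Fin r) F} {v : Fin r → F} {L : Set (Fin r → F)} :
    γ ∈ GammaSet v L ↔
      (fun x => Matrix.vecMul x (γ : Matrix (Fin r) (Fin r) F)) '' cosetOf v L = cosetOf v L :=
  Iff.rfl

lemma image_vecMul_mul (γ γ' : GL (Fin r) F) (C : Set (Fin r → F)) :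
    (fun x => Matrix.vecMul x ((γ * γ' : GL (Fin r) F) : Matrix (Fin r) (Fin r) F)) '' C =
      (fun x => Matrix.vecMul x (γ' : Matrix (Fin r) (Fin r) F)) ''
        ((fun x => Matrix.vecMul x (γ : Matrix (Fin r) (Fin r) F)) '' C) := by
  simp [Set.image_image, Matrix.vecMul_vecMul]

lemma one_mem_GammaSet (v : Fin r → F) (L : Set (Fin r → F)) : 1 ∈ GammaSet v L := by
  simp [mem_GammaSet_iff_image]

lemma mul_mem_GammaSet {v : Fin r → F} {L : Set (Fin r → F)} {γ γ' : GL (Fin r) F}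
    (h : γ ∈ GammaSet v L) (h' : γ' ∈ GammaSet v L) : γ * γ' ∈ GammaSet v L := by
  rw [mem_GammaSet_iff_image] at *
  rw [image_vecMul_mul, h, h']

lemma mul_inv_mem_GammaSet {v : Fin r → F} {L : Set (Fin r → F)} {γ γ' : GL (Fin r) F}
    (h : (fun x => Matrix.vecMul x (γ : Matrix (Fin r) (Fin r) F)) '' cosetOf v L =
      (fun x => Matrix.vecMul x (γ' : Matrix (Fin r) (Fin r) F)) '' cosetOf v L) :
    γ * γ'⁻¹ ∈ GammaSet v L := by
  rw [mem_GammaSet_iff_image, image_vecMul_mul, h, ← image_vecMul_mul]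
  simp

variable [IsFractionRing A F]

/-- A basis of a full lattice in `F^r`, viewed as a basis of `F^r`. -/
noncomputable def Module.Basis.ofLattice {L : Submodule A (Fin r → F)}
    (hL : Submodule.span F (L : Set (Fin r → F)) = ⊤) {ι : Type*} (b : Basis ι A L) :
    Basis ι F (Fin r → F) :=
  Basis.mk (v := fun i => (b i : Fin r → F))
    ((LinearIndependent.iff_fractionRing A F).1 (b.linearIndependent.map' L.subtype L.ker_subtype))
    (by
      rw [← hL, Submodule.span_le]
      intro y hy
      have h1 : (⟨y, hy⟩ : L) ∈ Submodule.span A (Set.range b) := b.span_eq ▸ Submodule.mem_top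
      have h2 := Submodule.mem_map_of_mem (f := L.subtype) h1
      rw [Submodule.map_span, ← Set.range_comp] at h2
      exact Submodule.span_subset_span A F _ h2)

lemma Module.Basis.ofLattice_apply {L : Submodule A (Fin r → F)}
    (hL : Submodule.span F (L : Set (Fin r → F)) = ⊤) {ι : Type*} (b : Basis ι A L) (i : ι) :
    b.ofLattice hL i = b i := by
  simp [ofLattice]

lemma exists_dotProduct_eq {L : Submodule A (Fin r → F)}
    (hL : Submodule.span F (L : Set (Fin r → F)) = ⊤) {ι : Type*} (b : Basis ι A L)
    (φ : Dual A L) : ∃ c : Fin r → F, ∀ y : L, (y : Fin r → F) ⬝ᵥ c = algebraMap A F (φ y) := by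
  let ψ : (Fin r → F) →ₗ[F] F := (b.ofLattice hL).constr F fun i => algebraMap A F (φ (b i))
  refine ⟨fun j => ψ (Pi.single j 1), fun y => ?_⟩
  have h1 : (y : Fin r → F) ⬝ᵥ (fun j => ψ (Pi.single j 1)) = ψ y := by
    conv_rhs => rw [← Finset.univ_sum_single (y : Fin r → F), map_sum]
    refine Finset.sum_congr rfl fun j _ => ?_
    rw [← smul_eq_mul, ← map_smul, ← Pi.single_smul, smul_eq_mul, mul_one]
  have h2 : (ψ.restrictScalars A) ∘ₗ L.subtype = Algebra.linearMap A F ∘ₗ φ :=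
    b.ext fun i => by
      simp only [LinearMap.comp_apply, Submodule.subtype_apply, LinearMap.restrictScalars_apply,
        Algebra.linearMap_apply, ψ]
      rw [← b.ofLattice_apply hL, Basis.constr_basis]
  rw [h1]
  exact LinearMap.congr_fun h2 y

/-- Transvections of a full lattice in `F^r` extend to elements of `GL_r(F)`. -/
lemma exists_rowAct_eq_transvection {L : Submodule A (Fin r → F)}
    (hL : Submodule.span F (L : Set (Fin r → F)) = ⊤) {ι : Type*} (b : Basis ι A L)
    (φ : Dual A L) {x : L} (hx : φ x = 0) :
    ∃ γ : GL (Fin r) F, ∀ y : L,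
      rowAct A γ y = (LinearMap.transvection φ x y : L) := by
  obtain ⟨c, hc⟩ := exists_dotProduct_eq hL b φ
  have hxc : (x : Fin r → F) ⬝ᵥ c = 0 := by rw [hc, hx, map_zero]
  have h0 : Matrix.vecMulVec c (x : Fin r → F) * Matrix.vecMulVec c (x : Fin r → F) = 0 := by
    rw [Matrix.vecMulVec_mul_vecMulVec, hxc, zero_smul, Matrix.vecMulVec_zero]
  refine ⟨⟨1 + Matrix.vecMulVec c x, 1 - Matrix.vecMulVec c x, ?_, ?_⟩, fun y => ?_⟩
  · rw [add_mul, mul_sub, mul_sub, h0]; simp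
  · rw [sub_mul, mul_add, mul_add, h0]; simp
  · rw [rowAct_apply, Matrix.vecMul_add, Matrix.vecMul_one, Matrix.vecMul_vecMulVec, hc,
      LinearMap.transvection.apply]
    simp [algebraMap_smul]

end RowAction

section HeckeDatum

open Module

variable {A F Λ : Type*} [CommRing A] [Field F] [Algebra A F] {r : ℕ} [AddCommGroup Λ]
  [Module A Λ]

/-- The part of the submodule `M` of `F^r` that lies in `L`, as a submodule of `L`, where `M` is
the translate of a submodule by an element of `GL_r(F)`. -/
def actLattice (L L' : Submodule A (Fin r → F)) (γ : GL (Fin r) F) : Submodule A L' :=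
  (L.map (rowAct A γ : (Fin r → F) →ₗ[A] (Fin r → F))).comap L'.subtype

lemma actLattice_mul_eq_map {L L' : Submodule A (Fin r → F)} (γ : GL (Fin r) F)
    {c : GL (Fin r) F} {g : L' ≃ₗ[A] L'} (hg : ∀ y : L', rowAct A c y = g y) :
    actLattice L L' (γ * c) = (actLattice L L' γ).map (g : L' →ₗ[A] L') := by
  ext y
  have h : (rowAct A c).symm y = g.symm y := by
    rw [LinearEquiv.symm_apply_eq, hg, LinearEquiv.apply_symm_apply]
  rw [actLattice, Submodule.mem_comap, map_rowAct_mul, Submodule.mem_map_equiv,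
    Submodule.subtype_apply, h, Submodule.mem_map_equiv (e := g)]
  rfl

lemma map_transvection_eq {M : Submodule A Λ} {φ ψ : Dual A Λ} {x : Λ} (hφ : φ x = 0)
    (hψ : ψ x = 0) (h : ∀ m ∈ M, (φ m - ψ m) • x ∈ M) :
    M.map (LinearMap.transvection φ x) = M.map (LinearMap.transvection ψ x) := by
  have key {φ ψ : Dual A Λ} (hψ : ψ x = 0) (h : ∀ m ∈ M, (φ m - ψ m) • x ∈ M) :
      M.map (LinearMap.transvection φ x) ≤ M.map (LinearMap.transvection ψ x) := by
    rintro _ ⟨m, hm, rfl⟩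
    refine ⟨m + (φ m - ψ m) • x, M.add_mem hm (h m hm), ?_⟩
    rw [LinearMap.transvection.apply, LinearMap.transvection.apply, map_add, map_smul, hψ, smul_zero,
      add_zero, add_assoc, ← add_smul, sub_add_cancel]
  refine le_antisymm (key hψ h) (key hφ fun m hm => ?_)
  rw [← neg_sub, neg_smul]
  exact M.neg_mem (h m hm)

/-- Representatives `R` of the left cosets in a double coset `Γ_{v+L}δΓ_{v'+L'}`, where
`vδ + Lδ ⊆ v' + L'`, the annihilator of `L'/Lδ` is generated by `N`, and some multiple `f` of the
denominator of `v` with respect to `L` is coprime to `N`. -/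
structure IsHeckeDatum (L L' : Submodule A (Fin r → F)) (v v' : Fin r → F) (δ : GL (Fin r) F)
    (R : Finset (GL (Fin r) F)) (f N : A) : Prop where
  image_subset : (fun x => Matrix.vecMul x (δ : Matrix (Fin r) (Fin r) F)) ''
    cosetOf v (L : Set (Fin r → F)) ⊆ cosetOf v' L'
  smul_mem : f • v ∈ L
  ne_zero : f ≠ 0
  isCoprime : IsCoprime f N
  dvd_iff (a : A) : (∀ y : L', a • y ∈ actLattice L L' δ) ↔ N ∣ a
  cover (g : GL (Fin r) F) : (∃ γ ∈ R, ∃ c ∈ GammaSet v (L : Set (Fin r → F)), g = c * γ) ↔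
    ∃ c ∈ GammaSet v (L : Set (Fin r → F)), ∃ c' ∈ GammaSet v' (L' : Set (Fin r → F)),
      g = c * δ * c'
  injOn : Set.InjOn (fun γ : GL (Fin r) F =>
    (fun x => Matrix.vecMul x (γ : Matrix (Fin r) (Fin r) F)) ''
      cosetOf v (L : Set (Fin r → F))) R

namespace IsHeckeDatum

variable {L L' : Submodule A (Fin r → F)} {v v' : Fin r → F} {δ : GL (Fin r) F}
  {R : Finset (GL (Fin r) F)} {f N : A}

lemma exists_image_eq (h : IsHeckeDatum L L' v v' δ R f N) {γ : GL (Fin r) F} (hγ : γ ∈ R) :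
    ∃ c ∈ GammaSet v' (L' : Set (Fin r → F)),
      (fun x => Matrix.vecMul x (γ : Matrix (Fin r) (Fin r) F)) ''
          cosetOf v (L : Set (Fin r → F)) =
        (fun x => Matrix.vecMul x ((δ * c : GL (Fin r) F) : Matrix (Fin r) (Fin r) F)) ''
          cosetOf v (L : Set (Fin r → F)) := by
  obtain ⟨c, hc, c', hc', rfl⟩ := (h.cover γ).1 ⟨γ, hγ, 1, one_mem_GammaSet _ _, (one_mul γ).symm⟩
  refine ⟨c', hc', ?_⟩
  rw [mul_assoc, image_vecMul_mul, mem_GammaSet_iff_image.1 hc]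

lemma image_subset_of_mem (h : IsHeckeDatum L L' v v' δ R f N) {γ : GL (Fin r) F} (hγ : γ ∈ R) :
    (fun x => Matrix.vecMul x (γ : Matrix (Fin r) (Fin r) F)) '' cosetOf v (L : Set (Fin r → F)) ⊆
      cosetOf v' L' := by
  obtain ⟨c, hc, hγc⟩ := h.exists_image_eq hγ
  rw [hγc, image_vecMul_mul, ← mem_GammaSet_iff_image.1 hc]
  exact Set.image_mono h.image_subset

lemma map_le (h : IsHeckeDatum L L' v v' δ R f N) {γ : GL (Fin r) F} (hγ : γ ∈ R) :
    L.map (rowAct A γ : (Fin r → F) →ₗ[A] (Fin r → F)) ≤ L' := by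
  have := h.image_subset_of_mem hγ
  rw [image_cosetOf, cosetOf_subset_iff] at this
  exact this.2

lemma exists_actLattice_eq_map (h : IsHeckeDatum L L' v v' δ R f N) {γ : GL (Fin r) F}
    (hγ : γ ∈ R) :
    ∃ g : L' ≃ₗ[A] L', actLattice L L' γ = (actLattice L L' δ).map (g : L' →ₗ[A] L') := by
  obtain ⟨c, hc, hγc⟩ := h.exists_image_eq hγ
  rw [image_cosetOf, image_cosetOf, cosetOf_eq_iff] at hγc
  refine ⟨(rowAct A c).ofSubmodules L' L' (mem_GammaSet_iff.1 hc).2, ?_⟩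
  rw [actLattice, hγc.2]
  exact actLattice_mul_eq_map δ fun y => rfl

lemma forall_smul_mem_iff (h : IsHeckeDatum L L' v v' δ R f N) {γ : GL (Fin r) F} (hγ : γ ∈ R)
    (a : A) : (∀ y, a • y ∈ actLattice L L' γ) ↔ N ∣ a := by
  obtain ⟨g, hg⟩ := h.exists_actLattice_eq_map hγ
  rw [hg, ← h.dvd_iff a, ← g.toEquiv.forall_congr_right]
  refine forall_congr' fun y => ?_
  rw [Submodule.mem_map_equiv, map_smul]
  exact iff_of_eq (congrArg (fun z => a • z ∈ actLattice L L' δ) (g.symm_apply_apply y))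

lemma mem_image_iff (h : IsHeckeDatum L L' v v' δ R f N) {γ : GL (Fin r) F} (hγ : γ ∈ R)
    {x : Fin r → F} :
    x ∈ (fun x => Matrix.vecMul x (γ : Matrix (Fin r) (Fin r) F)) ''
        cosetOf v (L : Set (Fin r → F)) ↔
      x - v' ∈ L' ∧ f • x ∈ L.map (rowAct A γ : (Fin r → F) →ₗ[A] (Fin r → F)) := by
  have hsub := h.image_subset_of_mem hγ
  have hfv : f • rowAct A γ v ∈ L.map (rowAct A γ : (Fin r → F) →ₗ[A] (Fin r → F)) :=
    ⟨f • v, h.smul_mem, map_smul _ _ _⟩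
  refine ⟨fun hx => ⟨hsub hx, ?_⟩, fun ⟨hx, hfx⟩ => ?_⟩
  · rw [image_cosetOf] at hx
    have := add_mem (Submodule.smul_mem _ f hx) hfv
    rwa [← smul_add, sub_add_cancel] at this
  · rw [image_cosetOf, cosetOf_subset_iff] at hsub
    have hy : x - rowAct A γ v ∈ L' := by
      have := sub_mem hx hsub.1
      rwa [sub_sub_sub_cancel_right] at this
    rw [image_cosetOf]
    have h1 : f • x - f • rowAct A γ v ∈
      L.map (rowAct A γ : (Fin r → F) →ₗ[A] (Fin r → F)) := sub_mem hfx hfv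
    rw [← smul_sub] at h1
    exact mem_of_isCoprime_smul_mem h.isCoprime h1
      ((h.forall_smul_mem_iff hγ N).2 dvd_rfl ⟨_, hy⟩)

lemma injOn_actLattice (h : IsHeckeDatum L L' v v' δ R f N) : Set.InjOn (actLattice L L') R := by
  intro γ hγ γ' hγ' heq
  have h1 := congrArg (Submodule.map L'.subtype) heq
  simp only [actLattice, Submodule.map_comap_subtype, inf_eq_right.2 (h.map_le hγ),
    inf_eq_right.2 (h.map_le hγ')] at h1
  refine h.injOn hγ hγ' (Set.ext fun x => ?_)
  rw [h.mem_image_iff hγ, h.mem_image_iff hγ', h1]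

lemma smul_mem_of_sub_mem (h : IsHeckeDatum L L' v v' δ R f N) {x : Fin r → F} (hx : x - v' ∈ L') :
    f • x ∈ L' := by
  have h1 := h.image_subset
  rw [image_cosetOf, cosetOf_subset_iff] at h1
  have h2 : f • rowAct A δ v ∈ L' := h1.2 ⟨f • v, h.smul_mem, map_smul _ _ _⟩
  have h3 := add_mem (L'.smul_mem f (sub_mem hx h1.1)) h2
  rwa [sub_sub_sub_cancel_right, ← smul_add, sub_add_cancel] at h3

open Classical in
lemma card_filter_mem_image (h : IsHeckeDatum L L' v v' δ R f N) {x : Fin r → F}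
    (hx : x - v' ∈ L') :
    (R.filter fun γ : GL (Fin r) F =>
      x ∈ (fun x => Matrix.vecMul x (γ : Matrix (Fin r) (Fin r) F)) ''
        cosetOf v (L : Set (Fin r → F))).card =
      ((R.image (actLattice L L')).filter fun M =>
        (⟨f • x, h.smul_mem_of_sub_mem hx⟩ : L') ∈ M).card := by
  rw [Finset.filter_image, Finset.card_image_of_injOn
    (h.injOn_actLattice.mono fun γ hγ => (Finset.mem_filter.1 hγ).1)]
  refine congrArg Finset.card (Finset.ext fun γ => ?_)
  rw [Finset.mem_filter, Finset.mem_filter]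
  refine and_congr_right fun hγ => ?_
  rw [h.mem_image_iff hγ, and_iff_right hx]
  rfl

lemma nonempty (h : IsHeckeDatum L L' v v' δ R f N) : R.Nonempty := by
  obtain ⟨γ, hγ, -⟩ := (h.cover δ).2
    ⟨1, one_mem_GammaSet _ _, 1, one_mem_GammaSet _ _, by rw [one_mul, mul_one]⟩
  exact ⟨γ, hγ⟩

open Classical in
lemma exists_isAdapted (h : IsHeckeDatum L L' v v' δ R f N) {π : A} {μ : Fin r → ℕ}
    (had : ∃ e : Fin r → L', IsAdapted π (actLattice L L' δ) μ e) :
    ∀ M ∈ R.image (actLattice L L'), ∃ e : Fin r → L', IsAdapted π M μ e := by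
  intro M hM
  obtain ⟨γ, hγ, rfl⟩ := Finset.mem_image.1 hM
  obtain ⟨g, hg⟩ := h.exists_actLattice_eq_map hγ
  obtain ⟨e, he⟩ := had
  exact ⟨g ∘ e, hg ▸ he.map g⟩

open Classical in
lemma forall_smul_mem_iff_of_mem_image (h : IsHeckeDatum L L' v v' δ R f N) :
    ∀ M ∈ R.image (actLattice L L'), ∀ a, (∀ y, a • y ∈ M) ↔ N ∣ a := by
  intro M hM
  obtain ⟨γ, hγ, rfl⟩ := Finset.mem_image.1 hM
  exact h.forall_smul_mem_iff hγ

open Classical in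
lemma exists_equiv_of_mem_image (h : IsHeckeDatum L L' v v' δ R f N) :
    ∀ M ∈ R.image (actLattice L L'), ∀ M' ∈ R.image (actLattice L L'),
      ∃ g : L' ≃ₗ[A] L', M' = M.map (g : L' →ₗ[A] L') := by
  intro M hM M' hM'
  obtain ⟨γ, hγ, rfl⟩ := Finset.mem_image.1 hM
  obtain ⟨γ', hγ', rfl⟩ := Finset.mem_image.1 hM'
  obtain ⟨g, hg⟩ := h.exists_actLattice_eq_map hγ
  obtain ⟨g', hg'⟩ := h.exists_actLattice_eq_map hγ'
  refine ⟨g.symm.trans g', ?_⟩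
  rw [hg, hg', ← Submodule.map_comp]
  congr 1
  exact LinearMap.ext fun x => by simp

variable [IsFractionRing A F]

lemma exists_actLattice_eq_map_transvection (h : IsHeckeDatum L L' v v' δ R f N)
    (hL' : Submodule.span F (L' : Set (Fin r → F)) = ⊤) {ι : Type*} (b : Basis ι A L')
    {γ : GL (Fin r) F} (hγ : γ ∈ R) (φ : Dual A L') {x : L'} (hx : φ x = 0) :
    ∃ γ' ∈ R, actLattice L L' γ' = (actLattice L L' γ).map (LinearMap.transvection φ x) := by
  obtain ⟨a, d, had⟩ := h.isCoprime
  have hφx : ((a * f) • φ) x = 0 := by rw [LinearMap.smul_apply, hx, smul_zero]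
  obtain ⟨c, hc⟩ := exists_rowAct_eq_transvection hL' b ((a * f) • φ) hφx
  have hcL : L'.map (rowAct A c : (Fin r → F) →ₗ[A] (Fin r → F)) = L' := by
    ext y
    rw [Submodule.mem_map]
    refine ⟨?_, fun hy => ?_⟩
    · rintro ⟨y, hy, rfl⟩
      exact (hc ⟨y, hy⟩).symm ▸ Subtype.property _
    · refine ⟨(LinearEquiv.transvection hφx).symm ⟨y, hy⟩, Subtype.property _, (hc _).trans ?_⟩
      exact congrArg Subtype.val ((LinearEquiv.transvection hφx).apply_symm_apply ⟨y, hy⟩)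
  have hcv : rowAct A c v' - v' ∈ L' := by
    have hfv : f • v' ∈ L' := h.smul_mem_of_sub_mem (by rw [sub_self]; exact L'.zero_mem)
    have h1 : f • (rowAct A c v' - v') = f • ((a * φ ⟨f • v', hfv⟩) • (x : Fin r → F)) := by
      have := hc ⟨f • v', hfv⟩
      rw [LinearMap.transvection.apply] at this
      rw [smul_sub, ← map_smul, this, smul_smul]
      simp [mul_assoc, mul_left_comm]
    have h2 : Function.Injective fun y : Fin r → F => f • y := by
      have hf : algebraMap A F f ≠ 0 :=
        (map_ne_zero_iff _ (IsFractionRing.injective A F)).2 h.ne_zero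
      intro y z hyz
      refine smul_right_injective _ hf ?_
      simpa only [algebraMap_smul] using hyz
    rw [h2 h1]
    exact L'.smul_mem _ x.2
  have hcΓ : c ∈ GammaSet v' (L' : Set (Fin r → F)) := mem_GammaSet_iff.2 ⟨hcv, hcL⟩
  obtain ⟨c₁, hc₁, c₂, hc₂, hγc⟩ :=
    (h.cover γ).1 ⟨γ, hγ, 1, one_mem_GammaSet _ _, (one_mul γ).symm⟩
  obtain ⟨γ', hγ', c₃, hc₃, hγc'⟩ := (h.cover (γ * c)).2
    ⟨c₁, hc₁, c₂ * c, mul_mem_GammaSet hc₂ hcΓ, by rw [hγc]; simp only [mul_assoc]⟩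
  refine ⟨γ', hγ', ?_⟩
  have h1 : actLattice L L' γ' = actLattice L L' (γ * c) := by
    rw [actLattice, actLattice, hγc', map_rowAct_mul, (mem_GammaSet_iff.1 hc₃).2]
  rw [h1, actLattice_mul_eq_map γ (g := LinearEquiv.transvection hφx) hc,
    LinearEquiv.transvection.coe_toLinearMap]
  refine map_transvection_eq hφx hx fun m hm => ?_
  have h2 : ((a * f) • φ) m - φ m = -(d * φ m) * N := by
    rw [LinearMap.smul_apply, smul_eq_mul]
    linear_combination φ m * had
  rw [h2, mul_smul]
  exact Submodule.smul_mem _ _ ((h.forall_smul_mem_iff hγ N).2 dvd_rfl x)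

open Classical in
lemma transvectionStable (h : IsHeckeDatum L L' v v' δ R f N)
    (hL' : Submodule.span F (L' : Set (Fin r → F)) = ⊤) {ι : Type*} (b : Basis ι A L') :
    TransvectionStable (R.image (actLattice L L')) := by
  intro M hM φ x hx
  obtain ⟨γ, hγ, rfl⟩ := Finset.mem_image.1 hM
  obtain ⟨γ', hγ', heq⟩ := h.exists_actLattice_eq_map_transvection hL' b hγ φ hx
  exact heq ▸ Finset.mem_image_of_mem _ hγ'

variable [IsDomain A] [IsPrincipalIdealRing A] {ℓ : ℕ} [Fact ℓ.Prime] [CharP A ℓ]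
  {ι : Type*} [Finite ι]

open Classical in
lemma card_modEq_zero_of_add_two_le (h : IsHeckeDatum L L' v v' δ R f N)
    (hL' : Submodule.span F (L' : Set (Fin r → F)) = ⊤) (b : Basis ι A L') (hN0 : N ≠ 0)
    {π : A} (hπ : Prime π) {μ : Fin r → ℕ} {i j l : Fin r} (hi : μ i = 0)
    (hl : ∀ j, μ j ≤ μ l) (hij : i ≠ j) (hjl : μ j + 2 ≤ μ l)
    (had : ∃ e : Fin r → L', IsAdapted π (actLattice L L' δ) μ e) {x : Fin r → F}
    (hx : x - v' ∈ L') :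
    (R.filter fun γ : GL (Fin r) F =>
      x ∈ (fun x => Matrix.vecMul x (γ : Matrix (Fin r) (Fin r) F)) ''
        cosetOf v (L : Set (Fin r → F))).card ≡ 0 [MOD ℓ] := by
  rw [h.card_filter_mem_image hx]
  exact card_filter_mem_modEq_zero_of_add_two_le b (h.transvectionStable hL' b) hN0
    h.forall_smul_mem_iff_of_mem_image hπ hi hl hij hjl (h.exists_isAdapted had) _

open Classical in
lemma card_modEq_zero_of_sq_dvd (h : IsHeckeDatum L L' v v' δ R f N)
    (hL' : Submodule.span F (L' : Set (Fin r → F)) = ⊤) (b : Basis ι A L') (hN0 : N ≠ 0)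
    {π : A} (hπ : Prime π) (hπN : π ^ 2 ∣ N) {μ : Fin r → ℕ} {i : Fin r} (hi : μ i = 0)
    (had : ∃ e : Fin r → L', IsAdapted π (actLattice L L' δ) μ e) {x : Fin r → F}
    (hx : x - v' ∈ L') (hfx : ∃ y ∈ L', f • x = π • y) :
    (R.filter fun γ : GL (Fin r) F =>
      x ∈ (fun x => Matrix.vecMul x (γ : Matrix (Fin r) (Fin r) F)) ''
        cosetOf v (L : Set (Fin r → F))).card ≡ 0 [MOD ℓ] := by
  obtain ⟨y, hy, hxy⟩ := hfx
  rw [h.card_filter_mem_image hx]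
  exact card_filter_mem_modEq_zero_of_sq_dvd b (h.transvectionStable hL' b) hN0
    h.forall_smul_mem_iff_of_mem_image hπ hπN hi (h.exists_isAdapted had)
    ⟨⟨y, hy⟩, Subtype.ext hxy⟩

open Classical in
lemma card_modEq_one_of_le_add_one [Nontrivial ι] (h : IsHeckeDatum L L' v v' δ R f N)
    (hL' : Submodule.span F (L' : Set (Fin r → F)) = ⊤) (b : Basis ι A L') (hN0 : N ≠ 0)
    {i l : Fin r} (had : ∀ π, Prime π → ∃ μ : Fin r → ℕ, μ i = 0 ∧ (∀ j, μ j ≤ μ l) ∧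
      (∀ j, j ≠ i → μ l ≤ μ j + 1) ∧
        ∃ e : Fin r → L', IsAdapted π (actLattice L L' δ) μ e) {x : Fin r → F}
    (hx : x - v' ∈ L') (hfx : ∀ π, Prime π → π ^ 2 ∣ N → ¬∃ y ∈ L', f • x = π • y) :
    (R.filter fun γ : GL (Fin r) F =>
      x ∈ (fun x => Matrix.vecMul x (γ : Matrix (Fin r) (Fin r) F)) ''
        cosetOf v (L : Set (Fin r → F))).card ≡ 1 [MOD ℓ] := by
  rw [h.card_filter_mem_image hx]
  refine card_filter_mem_modEq_one_of_le_add_one (i := i) (l := l) b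
    (h.transvectionStable hL' b) (h.nonempty.image _) h.exists_equiv_of_mem_image hN0
    h.forall_smul_mem_iff_of_mem_image (fun π hπ => ?_) ?_
  · obtain ⟨μ, h1, h2, h3, h4⟩ := had π hπ
    exact ⟨μ, h1, h2, h3, h.exists_isAdapted h4⟩
  · rintro π hπ hπN ⟨y, hy⟩
    exact hfx π hπ hπN ⟨y, y.2, congrArg Subtype.val hy⟩

end IsHeckeDatum

end HeckeDatum

section Localization

open Module

variable {A F V : Type*} [CommRing A] [Field F] [Algebra A F] [AddCommGroup V] [Module A V] {r : ℕ}

lemma exists_mem_forall_smul_mem (S : Submonoid A) {M M' : Submodule A V} (hM' : M'.FG)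
    (h : ∀ y ∈ M', ∃ s ∈ S, s • y ∈ M) : ∃ s ∈ S, ∀ y ∈ M', s • y ∈ M := by
  induction M', hM' using Submodule.fg_induction with
  | singleton x =>
    obtain ⟨s, hs, hsx⟩ := h x (Submodule.mem_span_singleton_self x)
    refine ⟨s, hs, fun y hy => ?_⟩
    obtain ⟨a, rfl⟩ := Submodule.mem_span_singleton.1 hy
    rw [smul_comm]
    exact M.smul_mem a hsx
  | sup M₁ M₂ _ _ h₁ h₂ =>
    obtain ⟨s, hs, hsM⟩ := h₁ fun y hy => h y (Submodule.mem_sup_left hy)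
    obtain ⟨t, ht, htM⟩ := h₂ fun y hy => h y (Submodule.mem_sup_right hy)
    refine ⟨s * t, S.mul_mem hs ht, fun y hy => ?_⟩
    obtain ⟨y₁, hy₁, y₂, hy₂, rfl⟩ := Submodule.mem_sup.1 hy
    rw [smul_add, mul_comm, mul_smul, mul_comm, mul_smul]
    exact M.add_mem (M.smul_mem t (hsM y₁ hy₁)) (M.smul_mem s (htM y₂ hy₂))

lemma exists_mem_nonZeroDivisors_smul_mem [Nontrivial A] [IsFractionRing A F] {L : Submodule A (Fin r → F)}
    (hL : Submodule.span F (L : Set (Fin r → F)) = ⊤) (y : Fin r → F) :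
    ∃ s ∈ nonZeroDivisors A, s • y ∈ L := by
  have hy : y ∈ Submodule.span F (L : Set (Fin r → F)) := hL ▸ Submodule.mem_top
  induction hy using Submodule.span_induction with
  | mem y hy => exact ⟨1, one_mem _, (one_smul A y).symm ▸ hy⟩
  | zero => exact ⟨1, one_mem _, by rw [smul_zero]; exact L.zero_mem⟩
  | add y z _ _ hy hz =>
    obtain ⟨s, hs, hsy⟩ := hy
    obtain ⟨t, ht, htz⟩ := hz
    refine ⟨s * t, mul_mem hs ht, ?_⟩
    rw [smul_add, mul_comm, mul_smul, mul_comm, mul_smul]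
    exact L.add_mem (L.smul_mem t hsy) (L.smul_mem s htz)
  | smul c y _ hy =>
    obtain ⟨s, hs, hsy⟩ := hy
    obtain ⟨a, t, ht, rfl⟩ := IsFractionRing.div_surjective (A := A) c
    refine ⟨s * t, mul_mem hs ht, ?_⟩
    have h0 : algebraMap A F t ≠ 0 := IsFractionRing.to_map_ne_zero_of_mem_nonZeroDivisors ht
    have h1 : (s * t) • (algebraMap A F a / algebraMap A F t) • y = a • s • y := by
      rw [← algebraMap_smul F, ← algebraMap_smul F a, ← algebraMap_smul F s, smul_smul, smul_smul,
        map_mul]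
      congr 1
      field_simp
    exact h1 ▸ L.smul_mem a hsy

lemma mem_of_forall_isMaximal {M : Submodule A V} {y : V}
    (h : ∀ p : Ideal A, p.IsMaximal → ∃ s, s ∉ p ∧ s • y ∈ M) : y ∈ M := by
  have h1 : M.colon {y} = ⊤ := by
    by_contra hne
    obtain ⟨p, hp, hle⟩ := Ideal.exists_le_maximal _ hne
    obtain ⟨s, hs, hsy⟩ := h p hp
    exact hs (hle (Submodule.mem_colon_singleton.2 hsy))
  rw [← one_smul A y, ← Submodule.mem_colon_singleton, h1]
  exact Submodule.mem_top

variable {Fq : Type*} [Field Fq]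

lemma mem_locSet_iff {M : Submodule (Polynomial Fq) (Fin r → RatFunc Fq)}
    {p : Ideal (Polynomial Fq)} {x : Fin r → RatFunc Fq} :
    x ∈ locSet (M : Set (Fin r → RatFunc Fq)) p ↔ ∃ s, s ∉ p ∧ s • x ∈ M := by
  refine exists_congr fun s => and_congr_right fun _ => ?_
  rw [SetLike.mem_coe]
  refine iff_of_eq (congrArg (· ∈ M) ?_)
  ext i
  rw [Pi.smul_apply, Algebra.smul_def]

/-- The localization of a submodule of `F^r` at a prime ideal, as a submodule. -/
def locSubmodule (M : Submodule (Polynomial Fq) (Fin r → RatFunc Fq)) (p : Ideal (Polynomial Fq))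
    [p.IsPrime] : Submodule (Polynomial Fq) (Fin r → RatFunc Fq) where
  carrier := locSet (M : Set (Fin r → RatFunc Fq)) p
  zero_mem' := mem_locSet_iff.2 ⟨1, Ideal.one_notMem p, by
    rw [smul_zero]; exact M.zero_mem⟩
  add_mem' {x y} hx hy := by
    obtain ⟨s, hs, hsx⟩ := mem_locSet_iff.1 hx
    obtain ⟨t, ht, hty⟩ := mem_locSet_iff.1 hy
    refine mem_locSet_iff.2 ⟨s * t, p.primeCompl.mul_mem hs ht, ?_⟩
    rw [smul_add, mul_comm, mul_smul, mul_comm, mul_smul]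
    exact M.add_mem (M.smul_mem t hsx) (M.smul_mem s hty)
  smul_mem' a x hx := by
    obtain ⟨s, hs, hsx⟩ := mem_locSet_iff.1 hx
    exact mem_locSet_iff.2 ⟨s, hs, smul_comm a s x ▸ M.smul_mem a hsx⟩

variable {L L' : Submodule (Polynomial Fq) (Fin r → RatFunc Fq)}
  {p : Ideal (Polynomial Fq)} [p.IsPrime]

lemma coe_locSubmodule : (locSubmodule L p : Set (Fin r → RatFunc Fq)) =
    locSet (L : Set (Fin r → RatFunc Fq)) p := rfl

lemma mem_locSubmodule {x : Fin r → RatFunc Fq} :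
    x ∈ locSubmodule L p ↔ ∃ s, s ∉ p ∧ s • x ∈ L := mem_locSet_iff

lemma le_locSubmodule : L ≤ locSubmodule L p := fun x hx =>
  mem_locSubmodule.2 ⟨1, Ideal.one_notMem p, by rwa [one_smul]⟩

lemma map_locSubmodule (g : (Fin r → RatFunc Fq) ≃ₗ[Polynomial Fq] (Fin r → RatFunc Fq)) :
    (locSubmodule L p).map
        (g : (Fin r → RatFunc Fq) →ₗ[Polynomial Fq] (Fin r → RatFunc Fq)) =
      locSubmodule (L.map (g : (Fin r → RatFunc Fq) →ₗ[Polynomial Fq] (Fin r → RatFunc Fq))) p := by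
  ext x
  simp only [Submodule.mem_map_equiv, mem_locSubmodule, map_smul]

lemma image_locSet (γ : GL (Fin r) (RatFunc Fq)) :
    (fun x => Matrix.vecMul x (γ : Matrix (Fin r) (Fin r) (RatFunc Fq))) ''
        locSet (L : Set (Fin r → RatFunc Fq)) p =
      locSubmodule (L.map (rowAct (Polynomial Fq) γ :
        (Fin r → RatFunc Fq) →ₗ[Polynomial Fq] (Fin r → RatFunc Fq))) p := by
  rw [← map_locSubmodule]
  rfl

lemma image_cosetOf_locSet (γ : GL (Fin r) (RatFunc Fq)) (v : Fin r → RatFunc Fq) :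
    (fun x => Matrix.vecMul x (γ : Matrix (Fin r) (Fin r) (RatFunc Fq))) ''
        cosetOf v (locSet (L : Set (Fin r → RatFunc Fq)) p) =
      cosetOf (rowAct (Polynomial Fq) γ v) (locSubmodule (L.map (rowAct (Polynomial Fq) γ :
        (Fin r → RatFunc Fq) →ₗ[Polynomial Fq] (Fin r → RatFunc Fq))) p) := by
  rw [← map_locSubmodule, ← image_cosetOf]
  rfl

end Localization

section LocalToGlobal

open Module

variable {Fq : Type*} [Field Fq] {r : ℕ}
  {L L' : Submodule (Polynomial Fq) (Fin r → RatFunc Fq)} {v v' : Fin r → RatFunc Fq}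
  {δ : GL (Fin r) (RatFunc Fq)} {R : Finset (GL (Fin r) (RatFunc Fq))}

lemma image_cosetOf_subset_of_forall_isMaximal
    (hA : ∀ p : Ideal (Polynomial Fq), p.IsMaximal →
      (fun x => Matrix.vecMul x (δ : Matrix (Fin r) (Fin r) (RatFunc Fq))) ''
          cosetOf v (locSet (L : Set (Fin r → RatFunc Fq)) p) ⊆
        cosetOf v' (locSet (L' : Set (Fin r → RatFunc Fq)) p)) :
    (fun x => Matrix.vecMul x (δ : Matrix (Fin r) (Fin r) (RatFunc Fq))) ''
      cosetOf v (L : Set (Fin r → RatFunc Fq)) ⊆ cosetOf v' L' := by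
  have h (p : Ideal (Polynomial Fq)) (hp : p.IsMaximal) :
      rowAct (Polynomial Fq) δ v - v' ∈ locSubmodule L' p ∧
        locSubmodule (L.map (rowAct (Polynomial Fq) δ :
          (Fin r → RatFunc Fq) →ₗ[Polynomial Fq] (Fin r → RatFunc Fq))) p ≤ locSubmodule L' p := by
    have := hA p hp
    rwa [image_cosetOf_locSet, ← coe_locSubmodule, cosetOf_subset_iff] at this
  rw [image_cosetOf, cosetOf_subset_iff]
  refine ⟨mem_of_forall_isMaximal fun p hp => mem_locSubmodule.1 (h p hp).1, fun x hx => ?_⟩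
  exact mem_of_forall_isMaximal fun p hp => mem_locSubmodule.1 ((h p hp).2 (le_locSubmodule hx))

lemma isCoprime_of_forall_isMaximal (hL'fg : L'.FG)
    (hB : ∀ p : Ideal (Polynomial Fq), p.IsMaximal →
      v ∉ locSet (L : Set (Fin r → RatFunc Fq)) p →
      (fun x => Matrix.vecMul x (δ : Matrix (Fin r) (Fin r) (RatFunc Fq))) ''
          cosetOf v (locSet (L : Set (Fin r → RatFunc Fq)) p) =
        cosetOf v' (locSet (L' : Set (Fin r → RatFunc Fq)) p))
    {f N : Polynomial Fq} (hf0 : f ≠ 0) (hf : ∀ a : Polynomial Fq, a • v ∈ L → f ∣ a)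
    (hN : ∀ a : Polynomial Fq, (∀ y : L', a • y ∈ actLattice L L' δ) → N ∣ a) :
    IsCoprime f N := by
  refine isCoprime_of_prime_dvd (fun h => hf0 h.1) fun π hπ hπf hπN => ?_
  have hp : (Ideal.span {π}).IsMaximal :=
    PrincipalIdealRing.isMaximal_of_irreducible hπ.irreducible
  have hv : v ∉ locSet (L : Set (Fin r → RatFunc Fq)) (Ideal.span {π}) := fun hv => by
    obtain ⟨s, hs, hsv⟩ := mem_locSet_iff.1 hv
    exact hs (Ideal.mem_span_singleton.2 (hπf.trans (hf s hsv)))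
  have h1 := hB _ hp hv
  rw [image_cosetOf_locSet, ← coe_locSubmodule, cosetOf_eq_iff] at h1
  obtain ⟨s, hs, hsM⟩ := exists_mem_forall_smul_mem (Ideal.span {π}).primeCompl hL'fg
    fun y hy => mem_locSubmodule.1 (h1.2.symm ▸ le_locSubmodule hy)
  exact hs (Ideal.mem_span_singleton.2 (hπN.trans (hN s fun y => hsM y y.2)))

lemma exists_isHeckeDatum (hL'fg : L'.FG)
    (hLspan : Submodule.span (RatFunc Fq) (L : Set (Fin r → RatFunc Fq)) = ⊤)
    (hA : ∀ p : Ideal (Polynomial Fq), p.IsMaximal →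
      (fun x => Matrix.vecMul x (δ : Matrix (Fin r) (Fin r) (RatFunc Fq))) ''
          cosetOf v (locSet (L : Set (Fin r → RatFunc Fq)) p) ⊆
        cosetOf v' (locSet (L' : Set (Fin r → RatFunc Fq)) p))
    (hB : ∀ p : Ideal (Polynomial Fq), p.IsMaximal →
      v ∉ locSet (L : Set (Fin r → RatFunc Fq)) p →
      (fun x => Matrix.vecMul x (δ : Matrix (Fin r) (Fin r) (RatFunc Fq))) ''
          cosetOf v (locSet (L : Set (Fin r → RatFunc Fq)) p) =
        cosetOf v' (locSet (L' : Set (Fin r → RatFunc Fq)) p))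
    (hcover : (⋃ γ ∈ R, {g : GL (Fin r) (RatFunc Fq) |
        ∃ c ∈ GammaSet v (L : Set (Fin r → RatFunc Fq)), g = c * γ}) =
      {g : GL (Fin r) (RatFunc Fq) | ∃ c ∈ GammaSet v (L : Set (Fin r → RatFunc Fq)),
        ∃ c' ∈ GammaSet v' (L' : Set (Fin r → RatFunc Fq)), g = c * δ * c'})
    (hdisj : ∀ γ1 ∈ R, ∀ γ2 ∈ R,
      {g : GL (Fin r) (RatFunc Fq) |
          ∃ c ∈ GammaSet v (L : Set (Fin r → RatFunc Fq)), g = c * γ1} =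
        {g : GL (Fin r) (RatFunc Fq) |
          ∃ c ∈ GammaSet v (L : Set (Fin r → RatFunc Fq)), g = c * γ2} →
      γ1 = γ2) :
    ∃ f N : Polynomial Fq, N ≠ 0 ∧ IsHeckeDatum L L' v v' δ R f N := by
  obtain ⟨f, hf⟩ := IsPrincipalIdealRing.principal (L.colon {v})
  obtain ⟨N, hN⟩ := IsPrincipalIdealRing.principal ((actLattice L L' δ).colon Set.univ)
  have hf' (a : Polynomial Fq) : a • v ∈ L ↔ f ∣ a := by
    rw [← Submodule.mem_colon_singleton, hf]
    exact Ideal.mem_span_singleton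
  have hN' (a : Polynomial Fq) : (∀ y : L', a • y ∈ actLattice L L' δ) ↔ N ∣ a := by
    rw [← Ideal.mem_span_singleton, ← Ideal.submodule_span_eq, ← hN, Submodule.mem_colon]
    simp
  have hf0 : f ≠ 0 := by
    obtain ⟨s, hs, hsv⟩ := exists_mem_nonZeroDivisors_smul_mem hLspan v
    exact ne_zero_of_dvd_ne_zero (nonZeroDivisors.ne_zero hs) ((hf' s).1 hsv)
  have hN0 : N ≠ 0 := by
    obtain ⟨s, hs, hsM⟩ := exists_mem_forall_smul_mem (nonZeroDivisors (Polynomial Fq)) hL'fg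
      (M := L.map (rowAct (Polynomial Fq) δ :
        (Fin r → RatFunc Fq) →ₗ[Polynomial Fq] (Fin r → RatFunc Fq))) fun y _ => by
      obtain ⟨s, hs, hsy⟩ := exists_mem_nonZeroDivisors_smul_mem hLspan
        ((rowAct (Polynomial Fq) δ).symm y)
      exact ⟨s, hs, (Submodule.mem_map_equiv _).2 (by rwa [map_smul])⟩
    exact ne_zero_of_dvd_ne_zero (nonZeroDivisors.ne_zero hs) ((hN' s).1 fun y => hsM y y.2)
  refine ⟨f, N, hN0, image_cosetOf_subset_of_forall_isMaximal hA, (hf' f).2 dvd_rfl, hf0,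
    isCoprime_of_forall_isMaximal hL'fg hB hf0 (fun a => (hf' a).1) (fun a => (hN' a).1), hN',
    fun g => ?_, fun γ₁ h₁ γ₂ h₂ heq => hdisj γ₁ h₁ γ₂ h₂ ?_⟩
  · simpa only [Set.mem_iUnion, exists_prop, Set.mem_ofPred_eq] using Set.ext_iff.1 hcover g
  · have key {γ₁ γ₂ : GL (Fin r) (RatFunc Fq)}
        (h : γ₁ * γ₂⁻¹ ∈ GammaSet v (L : Set (Fin r → RatFunc Fq))) :
        {g : GL (Fin r) (RatFunc Fq) |
          ∃ c ∈ GammaSet v (L : Set (Fin r → RatFunc Fq)), g = c * γ₁} ⊆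
        {g : GL (Fin r) (RatFunc Fq) |
          ∃ c ∈ GammaSet v (L : Set (Fin r → RatFunc Fq)), g = c * γ₂} := by
      rintro _ ⟨c, hc, rfl⟩
      exact ⟨c * (γ₁ * γ₂⁻¹), mul_mem_GammaSet hc h, by group⟩
    exact Set.Subset.antisymm (key (mul_inv_mem_GammaSet heq))
      (key (mul_inv_mem_GammaSet heq.symm))

end LocalToGlobal

section ElementaryDivisors

open Module

variable {Fq : Type*} [Field Fq] {r : ℕ}
  {L L' : Submodule (Polynomial Fq) (Fin r → RatFunc Fq)} {δ : GL (Fin r) (RatFunc Fq)}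
  {p : Ideal (Polynomial Fq)} [p.IsPrime] {e : Fin r → Fin r → RatFunc Fq}

lemma mem_apSpan_iff {x : Fin r → RatFunc Fq} :
    x ∈ apSpan p e ↔ ∃ s, s ∉ p ∧ ∃ a : Fin r → Polynomial Fq, s • x = ∑ j, a j • e j := by
  constructor
  · rintro ⟨c, hc, rfl⟩
    choose a s hs hcs using hc
    refine ⟨∏ j, s j, fun h => ?_, fun j => (∏ i ∈ Finset.univ.erase j, s i) * a j, ?_⟩
    · obtain ⟨j, -, hj⟩ := Ideal.IsPrime.prod_mem_iff.1 h
      exact hs j hj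
    · rw [Finset.smul_sum]
      refine Finset.sum_congr rfl fun j _ => ?_
      change _ • (c j • e j) = _
      rw [← Finset.prod_erase_mul _ _ (Finset.mem_univ j), mul_smul, mul_smul]
      congr 1
      rw [← algebraMap_smul (RatFunc Fq), ← algebraMap_smul (RatFunc Fq) (a j), smul_smul, ← hcs,
        mul_comm]
  · rintro ⟨s, hs, a, h⟩
    have hs0 : algebraMap (Polynomial Fq) (RatFunc Fq) s ≠ 0 := by
      rw [map_ne_zero_iff _ (IsFractionRing.injective _ _)]
      rintro rfl
      exact hs p.zero_mem
    refine ⟨fun j => algebraMap (Polynomial Fq) (RatFunc Fq) (a j) /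
      algebraMap (Polynomial Fq) (RatFunc Fq) s, fun j => ⟨a j, s, hs, div_mul_cancel₀ _ hs0⟩, ?_⟩
    refine smul_right_injective _ hs0 ?_
    change algebraMap (Polynomial Fq) (RatFunc Fq) s • x =
      algebraMap (Polynomial Fq) (RatFunc Fq) s •
        ∑ j, (algebraMap (Polynomial Fq) (RatFunc Fq) (a j) /
          algebraMap (Polynomial Fq) (RatFunc Fq) s) • e j
    rw [algebraMap_smul, h, Finset.smul_sum]
    refine Finset.sum_congr rfl fun j _ => ?_
    rw [smul_smul, mul_div_cancel₀ _ hs0, algebraMap_smul]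

lemma mem_apSpan_pow_iff {x : Fin r → RatFunc Fq} {g : Polynomial Fq} {μ : Fin r → ℕ} :
    x ∈ apSpan p (fun j => fun i => algebraMap (Polynomial Fq) (RatFunc Fq) (g ^ μ j) * e j i) ↔
      ∃ s, s ∉ p ∧ ∃ a : Fin r → Polynomial Fq, s • x = ∑ j, (a j * g ^ μ j) • e j := by
  rw [mem_apSpan_iff]
  refine exists_congr fun s => and_congr_right fun _ => exists_congr fun a => ?_
  refine iff_of_eq (congrArg (s • x = ·) (Finset.sum_congr rfl fun j _ => ?_))
  change a j • (algebraMap (Polynomial Fq) (RatFunc Fq) (g ^ μ j) • e j) = _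
  rw [algebraMap_smul, smul_smul]

lemma mem_apSpan_self (j : Fin r) : e j ∈ apSpan p e :=
  mem_apSpan_iff.2 ⟨1, Ideal.one_notMem p, Pi.single j 1, by simp [Pi.single_apply]⟩

lemma exists_isAdapted_actLattice
    (hL'span : Submodule.span (RatFunc Fq) (L' : Set (Fin r → RatFunc Fq)) = ⊤)
    {g : Polynomial Fq} (hp : p = Ideal.span {g}) {μ : Fin r → ℕ}
    (he : locSet (L' : Set (Fin r → RatFunc Fq)) p = apSpan p e)
    (heμ : (fun x => Matrix.vecMul x (δ : Matrix (Fin r) (Fin r) (RatFunc Fq))) ''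
        locSet (L : Set (Fin r → RatFunc Fq)) p =
      apSpan p (fun j => fun i => algebraMap (Polynomial Fq) (RatFunc Fq) (g ^ μ j) * e j i)) :
    ∃ e' : Fin r → L', IsAdapted g (actLattice L L' δ) μ e' := by
  have hdvd {s : Polynomial Fq} : s ∉ p ↔ ¬g ∣ s := by rw [hp, Ideal.mem_span_singleton]
  rw [image_locSet] at heμ
  have h1 (j : Fin r) : ∃ s, s ∉ p ∧ s • e j ∈ L' :=
    mem_locSet_iff.1 (he.symm ▸ mem_apSpan_self j)
  choose s hs hsL using h1
  obtain ⟨t, ht, htL⟩ : ∃ t, t ∉ p ∧ ∀ j, t • e j ∈ L' := by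
    refine ⟨∏ j, s j, fun h => ?_, fun j => ?_⟩
    · obtain ⟨j, -, hj⟩ := Ideal.IsPrime.prod_mem_iff.1 h
      exact hs j hj
    · rw [← Finset.prod_erase_mul _ _ (Finset.mem_univ j), mul_smul]
      exact L'.smul_mem _ (hsL j)
  have hmul {a b : Polynomial Fq} (ha : a ∉ p) (hb : b ∉ p) : ¬g ∣ a * b :=
    hdvd.1 (p.primeCompl.mul_mem ha hb)
  have hgen (y : L') : ∃ (s : Polynomial Fq) (c : Fin r → Polynomial Fq), ¬g ∣ s ∧
      s • y = ∑ j, c j • (⟨t • e j, htL j⟩ : L') := by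
    obtain ⟨s, hs, a, h⟩ := mem_apSpan_iff.1 (he ▸ mem_locSet_iff.2
      ⟨1, Ideal.one_notMem p, by rw [one_smul]; exact y.2⟩ : (y : Fin r → RatFunc Fq) ∈ apSpan p e)
    refine ⟨t * s, a, hmul ht hs, Subtype.ext ?_⟩
    simp only [Submodule.coe_smul, Submodule.coe_sum, mul_smul, h, Finset.smul_sum]
    exact Finset.sum_congr rfl fun j _ => smul_comm _ _ _
  refine ⟨fun j => ⟨t • e j, htL j⟩, ?_, hgen, fun y hy => ?_, fun j => ?_⟩
  · have htop : ⊤ ≤ Submodule.span (RatFunc Fq) (Set.range fun j => t • e j) := by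
      rw [← hL'span, Submodule.span_le]
      intro y hy
      obtain ⟨s, c, hs, hsc⟩ := hgen ⟨y, hy⟩
      have hs0 : algebraMap (Polynomial Fq) (RatFunc Fq) s ≠ 0 := by
        rw [map_ne_zero_iff _ (IsFractionRing.injective _ _)]
        rintro rfl
        exact hs (dvd_zero g)
      have h2 := congrArg Subtype.val hsc
      simp only [Submodule.coe_smul, Submodule.coe_sum] at h2
      rw [SetLike.mem_coe, ← Submodule.smul_mem_iff _ hs0, algebraMap_smul, h2]
      refine Submodule.sum_mem _ fun j _ => ?_
      rw [← algebraMap_smul (RatFunc Fq) (c j)]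
      exact Submodule.smul_mem _ _ (Submodule.subset_span ⟨j, rfl⟩)
    have hli := linearIndependent_of_top_le_span_of_card_eq_finrank htop (by simp)
    exact LinearIndependent.of_comp L'.subtype
      ((LinearIndependent.iff_fractionRing (Polynomial Fq) (RatFunc Fq)).2 hli)
  · have hy' : (y : Fin r → RatFunc Fq) ∈ apSpan p
        (fun j => fun i => algebraMap (Polynomial Fq) (RatFunc Fq) (g ^ μ j) * e j i) :=
      heμ ▸ le_locSubmodule hy
    obtain ⟨s, hs, a, h⟩ := mem_apSpan_pow_iff.1 hy'
    refine ⟨t * s, a, hmul ht hs, Subtype.ext ?_⟩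
    simp only [Submodule.coe_smul, Submodule.coe_sum, mul_smul t s, h, Finset.smul_sum]
    exact Finset.sum_congr rfl fun j _ => smul_comm _ _ _
  · have hj : g ^ μ j • e j ∈ apSpan p
        (fun j => fun i => algebraMap (Polynomial Fq) (RatFunc Fq) (g ^ μ j) * e j i) :=
      mem_apSpan_pow_iff.2 ⟨1, Ideal.one_notMem p, Pi.single j 1, by simp [Pi.single_apply]⟩
    rw [← heμ] at hj
    obtain ⟨s, hs, hsj⟩ := mem_locSubmodule.1 hj
    refine ⟨s, hdvd.1 hs, ?_⟩
    change (s * g ^ μ j) • t • e j ∈ L.map _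
    rw [smul_comm, mul_smul]
    exact Submodule.smul_mem _ t hsj

lemma exists_eq_zero_of_not_subset {g : Polynomial Fq} (hp : p = Ideal.span {g}) {μ : Fin r → ℕ}
    (he : locSet (L' : Set (Fin r → RatFunc Fq)) p = apSpan p e)
    (heμ : (fun x => Matrix.vecMul x (δ : Matrix (Fin r) (Fin r) (RatFunc Fq))) ''
        locSet (L : Set (Fin r → RatFunc Fq)) p =
      apSpan p (fun j => fun i => algebraMap (Polynomial Fq) (RatFunc Fq) (g ^ μ j) * e j i))
    (hC : ¬((fun x => Matrix.vecMul x (δ : Matrix (Fin r) (Fin r) (RatFunc Fq))) ''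
          locSet (L : Set (Fin r → RatFunc Fq)) p ⊆
        locSet ((p • L' : Submodule (Polynomial Fq) (Fin r → RatFunc Fq)) :
          Set (Fin r → RatFunc Fq)) p)) : ∃ j, μ j = 0 := by
  contrapose! hC
  rw [heμ]
  intro x hx
  obtain ⟨s, hs, a, h⟩ := mem_apSpan_pow_iff.1 hx
  have hy : ∑ j, (a j * g ^ (μ j - 1)) • e j ∈ apSpan p e :=
    mem_apSpan_iff.2 ⟨1, Ideal.one_notMem p, _, one_smul _ _⟩
  rw [← he] at hy
  obtain ⟨t, ht, htL⟩ := mem_locSet_iff.1 hy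
  refine mem_locSet_iff.2 ⟨t * s, p.primeCompl.mul_mem ht hs, ?_⟩
  have h1 : s • x = g • ∑ j, (a j * g ^ (μ j - 1)) • e j := by
    rw [h, Finset.smul_sum]
    refine Finset.sum_congr rfl fun j _ => ?_
    obtain ⟨m, hm⟩ := Nat.exists_eq_succ_of_ne_zero (hC j)
    rw [smul_smul, hm, Nat.succ_sub_one, pow_succ]
    congr 1
    ring
  rw [mul_smul, h1, smul_comm]
  exact Submodule.smul_mem_smul (hp ▸ Ideal.mem_span_singleton_self g) htL

end ElementaryDivisors

section IdealCosets

variable {A V : Type*} [CommRing A] [AddCommGroup V] [Module A V] {L' : Submodule A V}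

lemma mem_smul_of_smul_mem {p : Ideal A} [p.IsMaximal] {s : A} (hs : s ∉ p) {y : V} (hy : y ∈ L')
    (h : s • y ∈ p • L') : y ∈ p • L' := by
  obtain ⟨a, b, hb, hab⟩ := Ideal.IsMaximal.exists_inv ‹_› hs
  rw [← one_smul A y, ← hab, add_smul, mul_smul]
  exact add_mem (Submodule.smul_mem _ a h) (Submodule.smul_mem_smul hb hy)

lemma smul_inf_smul_le_of_isCoprime {P Q : Ideal A} (h : IsCoprime P Q) :
    P • L' ⊓ Q • L' ≤ (P * Q) • L' := by
  rintro x ⟨hP, hQ⟩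
  obtain ⟨a, ha, b, hb, hab⟩ := Ideal.isCoprime_iff_exists.1 h
  rw [← one_smul A x, ← hab, add_smul]
  refine add_mem ?_ ?_
  · rw [mul_smul]
    exact Submodule.smul_mem_smul ha hQ
  · rw [mul_comm, mul_smul]
    exact Submodule.smul_mem_smul hb hP

lemma mem_prod_smul_iff {I : Finset (Ideal A)} (hI : ∀ p ∈ I, p.IsMaximal) {x : V} :
    x ∈ (∏ p ∈ I, p) • L' ↔ x ∈ L' ∧ ∀ p ∈ I, x ∈ p • L' := by
  classical
  induction I using Finset.induction_on with
  | empty => simp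
  | insert p I hp ih =>
    have hcop : IsCoprime p (∏ q ∈ I, q) := IsCoprime.prod_right fun q hq => by
      have := hI p (Finset.mem_insert_self _ _)
      have := hI q (Finset.mem_insert_of_mem hq)
      exact Ideal.isCoprime_of_isMaximal (fun h => hp (h ▸ hq))
    rw [Finset.prod_insert hp, Finset.forall_mem_insert, and_left_comm,
      ← ih fun q hq => hI q (Finset.mem_insert_of_mem hq), ← Submodule.mem_inf]
    refine ⟨fun h => ⟨?_, ?_⟩, fun h => smul_inf_smul_le_of_isCoprime hcop h⟩
    · rw [mul_smul] at h
      exact Submodule.smul_mono le_rfl Submodule.smul_le_right h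
    · rw [mul_comm, mul_smul] at h
      exact Submodule.smul_mono le_rfl Submodule.smul_le_right h

lemma mem_span_singleton_smul_iff {π : A} {x : V} :
    x ∈ Ideal.span {π} • L' ↔ ∃ y ∈ L', x = π • y := by
  rw [Submodule.ideal_span_singleton_smul, Submodule.mem_smul_pointwise_iff_exists]
  simp only [eq_comm]

open Classical in
lemma sum_powerset_neg_one_pow_indicator {S : Finset (Ideal A)} (hS : ∀ p ∈ S, p.IsMaximal)
    (x : V) :
    ∑ I ∈ S.powerset, (-1 : ℤ) ^ I.card * (if x ∈ (∏ p ∈ I, p) • L' then 1 else 0) =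
      if x ∈ L' ∧ ∀ p ∈ S, x ∉ p • L' then 1 else 0 := by
  by_cases hx : x ∈ L'
  · have h : ∑ I ∈ S.powerset, (-1 : ℤ) ^ I.card * (if x ∈ (∏ p ∈ I, p) • L' then 1 else 0) =
        ∑ I ∈ (S.filter fun p => x ∈ p • L').powerset, (-1 : ℤ) ^ I.card := by
      simp only [mul_ite, mul_one, mul_zero]
      rw [← Finset.sum_filter]
      refine Finset.sum_congr ?_ fun _ _ => rfl
      ext I
      simp only [Finset.mem_filter, Finset.mem_powerset, Finset.subset_iff]
      refine ⟨fun h p hp => ⟨h.1 hp, ((mem_prod_smul_iff fun q hq => hS q (h.1 hq)).1 h.2).2 p hp⟩,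
        fun h => ⟨fun p hp => (h hp).1, (mem_prod_smul_iff fun q hq => hS q (h hq).1).2
          ⟨hx, fun p hp => (h hp).2⟩⟩⟩
    rw [h, Finset.sum_powerset_neg_one_pow_card]
    simp only [hx, true_and, Finset.filter_eq_empty_iff]
  · rw [if_neg fun h => hx h.1]
    exact Finset.sum_eq_zero fun I _ => by
      rw [if_neg fun h => hx (Submodule.smul_le_right h), mul_zero]

end IdealCosets

section EisensteinCount

open Module

variable {Fq : Type*} [Field Fq] {r : ℕ}
  {L L' : Submodule (Polynomial Fq) (Fin r → RatFunc Fq)} {v v' : Fin r → RatFunc Fq}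
  {δ : GL (Fin r) (RatFunc Fq)} {R : Finset (GL (Fin r) (RatFunc Fq))}
  {f N : Polynomial Fq} {μ : Ideal (Polynomial Fq) → Fin r → ℕ} {i l : Fin r}

lemma exists_isAdapted_of_prime (hi : ∀ j, j ≤ i)
    (hL'span : Submodule.span (RatFunc Fq) (L' : Set (Fin r → RatFunc Fq)) = ⊤)
    (hC : ∀ p : Ideal (Polynomial Fq), p.IsMaximal →
      ¬ ((fun x => Matrix.vecMul x (δ : Matrix (Fin r) (Fin r) (RatFunc Fq))) ''
          locSet (L : Set (Fin r → RatFunc Fq)) p ⊆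
        locSet ((p • L' : Submodule (Polynomial Fq) (Fin r → RatFunc Fq)) :
          Set (Fin r → RatFunc Fq)) p))
    (hμanti : ∀ p, Antitone (μ p))
    (hμdiv : ∀ p : Ideal (Polynomial Fq), p.IsMaximal →
      ∃ g : Polynomial Fq, p = Ideal.span {g} ∧
      ∃ e : Fin r → (Fin r → RatFunc Fq),
        locSet (L' : Set (Fin r → RatFunc Fq)) p = apSpan p e ∧
        (fun x => Matrix.vecMul x (δ : Matrix (Fin r) (Fin r) (RatFunc Fq))) ''
            locSet (L : Set (Fin r → RatFunc Fq)) p =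
          apSpan p (fun j => fun i => algebraMap (Polynomial Fq) (RatFunc Fq) (g ^ μ p j) * e j i))
    {π : Polynomial Fq} (hπ : Prime π) :
    μ (Ideal.span {π}) i = 0 ∧
      ∃ e : Fin r → L', IsAdapted π (actLattice L L' δ) (μ (Ideal.span {π})) e := by
  have hp : (Ideal.span {π}).IsMaximal :=
    PrincipalIdealRing.isMaximal_of_irreducible hπ.irreducible
  obtain ⟨g, hg, e, he, heμ⟩ := hμdiv _ hp
  obtain ⟨j, hj⟩ := exists_eq_zero_of_not_subset hg he heμ (hC _ hp)
  obtain ⟨e', he'⟩ := exists_isAdapted_actLattice hL'span hg he heμ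
  exact ⟨Nat.eq_zero_of_le_zero (hj ▸ hμanti _ (hi j)), e',
    he'.of_associated (Ideal.span_singleton_eq_span_singleton.1 hg).symm⟩

namespace IsHeckeDatum

lemma sq_dvd_iff (h : IsHeckeDatum L L' v v' δ R f N) (hL'fg : L'.FG) (hN0 : N ≠ 0)
    {π : Polynomial Fq} (hπ : Prime π) {μ : Fin r → ℕ} (hl : ∀ j, μ j ≤ μ l)
    (had : ∃ e : Fin r → L', IsAdapted π (actLattice L L' δ) μ e) :
    π ^ 2 ∣ N ↔ 2 ≤ μ l := by
  have : Module.Finite (Polynomial Fq) L' := Module.Finite.iff_fg.2 hL'fg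
  obtain ⟨e, he⟩ := had
  obtain ⟨m, N', hN', rfl⟩ := WfDvdMonoid.max_power_factor hN0 hπ.irreducible
  rw [he.eq_of_forall_smul_mem_iff hπ h.dvd_iff rfl hN' hl]
  refine ⟨fun hd => ?_, fun hm => (pow_dvd_pow π hm).mul_right _⟩
  by_contra! hm
  exact hN' ((mul_dvd_mul_iff_left (pow_ne_zero m hπ.ne_zero)).1
    ((pow_succ π m ▸ pow_dvd_pow π hm).trans hd))

lemma exists_prime_of_two_le (h : IsHeckeDatum L L' v v' δ R f N) (hL'fg : L'.FG) (hN0 : N ≠ 0)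
    (hl : ∀ p j, μ p j ≤ μ p l)
    (had : ∀ π, Prime π →
      ∃ e : Fin r → L', IsAdapted π (actLattice L L' δ) (μ (Ideal.span {π})) e)
    {p : Ideal (Polynomial Fq)} (hp : p.IsMaximal) (hμ : 2 ≤ μ p l) :
    ∃ π, Prime π ∧ p = Ideal.span {π} ∧ π ^ 2 ∣ N := by
  obtain ⟨π, rfl⟩ := IsPrincipalIdealRing.principal p
  rw [Ideal.submodule_span_eq] at hp hμ ⊢
  have hπ0 : π ≠ 0 := by
    rintro rfl
    exact Polynomial.not_isField Fq
      (Ring.isField_iff_maximal_bot.2 (by rwa [Set.singleton_zero, Ideal.span_zero] at hp))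
  have hπ := (Ideal.span_singleton_prime hπ0).1 hp.isPrime
  exact ⟨π, hπ, rfl, (h.sq_dvd_iff hL'fg hN0 hπ (hl _) (had π hπ)).2 hμ⟩

lemma finite_setOf_two_le (h : IsHeckeDatum L L' v v' δ R f N) (hL'fg : L'.FG) (hN0 : N ≠ 0)
    (hl : ∀ p j, μ p j ≤ μ p l)
    (had : ∀ π, Prime π →
      ∃ e : Fin r → L', IsAdapted π (actLattice L L' δ) (μ (Ideal.span {π})) e) :
    {p : Ideal (Polynomial Fq) | p.IsMaximal ∧ 2 ≤ μ p l}.Finite := by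
  have := UniqueFactorizationMonoid.fintypeSubtypeDvd (Ideal.span {N})
    (by rwa [Ne, Ideal.zero_eq_bot, Ideal.span_singleton_eq_bot])
  refine ((Set.finite_coe_iff (s := {p | p ∣ Ideal.span {N}})).1
    (Finite.of_fintype {p // p ∣ Ideal.span {N}})).subset ?_
  rintro p ⟨hp, hμ⟩
  obtain ⟨π, -, rfl, hN⟩ := h.exists_prime_of_two_le hL'fg hN0 hl had hp hμ
  exact Ideal.dvd_iff_le.2 (Ideal.span_singleton_le_span_singleton.2
    ((dvd_pow_self π two_ne_zero).trans hN))

lemma notMem_of_mem (h : IsHeckeDatum L L' v v' δ R f N) {p : Ideal (Polynomial Fq)}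
    (hp : p.IsMaximal) (hN : N ∈ p) : f ∉ p := fun hf => by
  obtain ⟨a, b, hab⟩ := h.isCoprime
  exact Ideal.one_notMem p (hab ▸ add_mem (p.mul_mem_left a hf) (p.mul_mem_left b hN))

lemma exists_sub_mem (h : IsHeckeDatum L L' v v' δ R f N) :
    ∃ v'' : Fin r → RatFunc Fq, v'' - v' ∈ L' ∧
      ∀ p : Ideal (Polynomial Fq), p.IsMaximal → N ∈ p →
        v'' ∈ locSet ((p • L' : Submodule (Polynomial Fq) (Fin r → RatFunc Fq)) :
          Set (Fin r → RatFunc Fq)) p := by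
  obtain ⟨a, b, hab⟩ := h.isCoprime
  have hfv : f • v' ∈ L' := h.smul_mem_of_sub_mem (by rw [sub_self]; exact L'.zero_mem)
  have hv : v' - a • f • v' = b • N • v' := by
    rw [sub_eq_iff_eq_add', ← mul_smul, ← mul_smul, ← add_smul, hab, one_smul]
  refine ⟨v' - a • f • v', ?_, fun p hp hN => ?_⟩
  · rw [sub_sub_cancel_left]
    exact neg_mem (L'.smul_mem a hfv)
  · refine mem_locSet_iff.2 ⟨f, h.notMem_of_mem hp hN, ?_⟩
    rw [hv, smul_comm, smul_comm f N]
    exact Submodule.smul_mem _ b (Submodule.smul_mem_smul hN hfv)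

lemma smul_mem_smul_iff (h : IsHeckeDatum L L' v v' δ R f N) {p : Ideal (Polynomial Fq)}
    (hp : p.IsMaximal) (hN : N ∈ p) {v'' x : Fin r → RatFunc Fq} (hv'' : v'' - v' ∈ L')
    (hv''p : v'' ∈ locSet ((p • L' : Submodule (Polynomial Fq) (Fin r → RatFunc Fq)) :
          Set (Fin r → RatFunc Fq)) p) (hx : x - v' ∈ L') :
    f • x ∈ p • L' ↔ x - v'' ∈ p • L' := by
  have hf := h.notMem_of_mem hp hN
  obtain ⟨s, hs, hsv⟩ := mem_locSet_iff.1 hv''p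
  have hfv : f • v'' ∈ p • L' := by
    refine mem_smul_of_smul_mem hs (h.smul_mem_of_sub_mem hv'') ?_
    rw [smul_comm]
    exact Submodule.smul_mem _ f hsv
  have hxv : x - v'' ∈ L' := by
    rw [← sub_sub_sub_cancel_right x v'' v']
    exact sub_mem hx hv''
  refine ⟨fun hfx => mem_smul_of_smul_mem hf hxv ?_, fun hxv => ?_⟩
  · rw [smul_sub]
    exact sub_mem hfx hfv
  · rw [← sub_add_cancel x v'', smul_add]
    exact add_mem (Submodule.smul_mem _ f hxv) hfv

variable {ℓ : ℕ} [Fact ℓ.Prime] [CharP Fq ℓ]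

open Classical in
lemma card_modEq_zero (h : IsHeckeDatum L L' v v' δ R f N) (hL'fg : L'.FG)
    (hL'span : Submodule.span (RatFunc Fq) (L' : Set (Fin r → RatFunc Fq)) = ⊤)
    (hN0 : N ≠ 0) {j : Fin r} (hl : ∀ p j, μ p j ≤ μ p l)
    (had : ∀ π, Prime π → μ (Ideal.span {π}) i = 0 ∧
      ∃ e : Fin r → L', IsAdapted π (actLattice L L' δ) (μ (Ideal.span {π})) e)
    {p : Ideal (Polynomial Fq)} (hp : p.IsMaximal) (hij : i ≠ j) (hjl : μ p j + 2 ≤ μ p l)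
    (x : Fin r → RatFunc Fq) :
    (R.filter fun γ : GL (Fin r) (RatFunc Fq) =>
      x ∈ (fun x => Matrix.vecMul x (γ : Matrix (Fin r) (Fin r) (RatFunc Fq))) ''
        cosetOf v (L : Set (Fin r → RatFunc Fq))).card ≡ 0 [MOD ℓ] := by
  have : Module.Finite (Polynomial Fq) L' := Module.Finite.iff_fg.2 hL'fg
  obtain ⟨π, hπ, rfl, -⟩ := h.exists_prime_of_two_le hL'fg hN0 hl (fun π hπ => (had π hπ).2) hp
    (le_of_add_le_right hjl)
  by_cases hx : x - v' ∈ L'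
  · exact h.card_modEq_zero_of_add_two_le hL'span (Module.Free.chooseBasis (Polynomial Fq) L') hN0
      hπ (had π hπ).1 (hl _) hij hjl (had π hπ).2 hx
  · rw [Finset.filter_false_of_mem fun γ hγ hxγ => hx (h.image_subset_of_mem hγ hxγ)]
    rfl

open Classical in
lemma card_modEq_sum (h : IsHeckeDatum L L' v v' δ R f N) (hr : 2 ≤ r) (hL'fg : L'.FG)
    (hL'span : Submodule.span (RatFunc Fq) (L' : Set (Fin r → RatFunc Fq)) = ⊤)
    (hN0 : N ≠ 0) (hl : ∀ p j, μ p j ≤ μ p l)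
    (had : ∀ π, Prime π → μ (Ideal.span {π}) i = 0 ∧
      ∃ e : Fin r → L', IsAdapted π (actLattice L L' δ) (μ (Ideal.span {π})) e)
    (hμ : ∀ p : Ideal (Polynomial Fq), p.IsMaximal → ∀ j, j ≠ i → μ p l ≤ μ p j + 1)
    {S : Finset (Ideal (Polynomial Fq))} (hS : ∀ p, p ∈ S ↔ p.IsMaximal ∧ 2 ≤ μ p l)
    {v'' : Fin r → RatFunc Fq} (hv'' : v'' - v' ∈ L')
    (hv''S : ∀ p ∈ S, v'' ∈ locSet ((p • L' : Submodule (Polynomial Fq) (Fin r → RatFunc Fq)) :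
      Set (Fin r → RatFunc Fq)) p) (x : Fin r → RatFunc Fq) :
    ((R.filter fun γ : GL (Fin r) (RatFunc Fq) =>
      x ∈ (fun x => Matrix.vecMul x (γ : Matrix (Fin r) (Fin r) (RatFunc Fq))) ''
        cosetOf v (L : Set (Fin r → RatFunc Fq))).card : ℤ) ≡
      ∑ I ∈ S.powerset, (-1) ^ I.card * (if x ∈ cosetOf v'' (((∏ p ∈ I, p) • L' :
        Submodule (Polynomial Fq) (Fin r → RatFunc Fq)) : Set (Fin r → RatFunc Fq))
          then 1 else 0) [ZMOD ℓ] := by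
  have : Module.Finite (Polynomial Fq) L' := Module.Finite.iff_fg.2 hL'fg
  let b := Module.Free.chooseBasis (Polynomial Fq) L'
  have hp {π : Polynomial Fq} (hπ : Prime π) : (Ideal.span {π}).IsMaximal :=
    PrincipalIdealRing.isMaximal_of_irreducible hπ.irreducible
  have hsq {π : Polynomial Fq} (hπ : Prime π) : π ^ 2 ∣ N ↔ 2 ≤ μ (Ideal.span {π}) l :=
    h.sq_dvd_iff hL'fg hN0 hπ (hl _) (had π hπ).2
  simp only [mem_cosetOf, SetLike.mem_coe]
  rw [sum_powerset_neg_one_pow_indicator fun p hp => ((hS p).1 hp).1]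
  have hxv : x - v'' ∈ L' ↔ x - v' ∈ L' := by
    rw [← sub_sub_sub_cancel_right x v'' v', Submodule.sub_mem_iff_left _ hv'']
  have hfx {π : Polynomial Fq} (hπ : Prime π) (hπN : π ^ 2 ∣ N) (hx : x - v' ∈ L') :
      (∃ y ∈ L', f • x = π • y) ↔ x - v'' ∈ Ideal.span {π} • L' := by
    rw [← mem_span_singleton_smul_iff]
    refine h.smul_mem_smul_iff (hp hπ) ?_ hv'' (hv''S _ ((hS _).2 ⟨hp hπ, (hsq hπ).1 hπN⟩)) hx
    exact Ideal.mem_span_singleton.2 ((dvd_pow_self π two_ne_zero).trans hπN)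
  by_cases hx : x - v' ∈ L'
  · split_ifs with hD
    · have : Nontrivial (Module.Free.ChooseBasisIndex (Polynomial Fq) L') := by
        have hcard := Module.finrank_eq_card_basis (b.ofLattice hL'span)
        rw [Module.finrank_fin_fun] at hcard
        exact Fintype.one_lt_card_iff_nontrivial.1 (by omega)
      refine Int.natCast_modEq_iff.2 (h.card_modEq_one_of_le_add_one hL'span b hN0 (i := i) (l := l)
        (fun π hπ => ⟨μ (Ideal.span {π}), (had π hπ).1, hl _, hμ _ (hp hπ), (had π hπ).2⟩) hx
        fun π hπ hπN hy => hD.2 _ ((hS _).2 ⟨hp hπ, (hsq hπ).1 hπN⟩) ((hfx hπ hπN hx).1 hy))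
    · simp only [hxv, hx, true_and, not_forall, not_not] at hD
      obtain ⟨p, hpS, hxp⟩ := hD
      obtain ⟨hp', hμp⟩ := (hS p).1 hpS
      obtain ⟨π, hπ, rfl, hπN⟩ :=
        h.exists_prime_of_two_le hL'fg hN0 hl (fun π hπ => (had π hπ).2) hp' hμp
      exact Int.natCast_modEq_iff.2 (h.card_modEq_zero_of_sq_dvd hL'span b hN0 hπ hπN (had π hπ).1
        (had π hπ).2 hx ((hfx hπ hπN hx).2 hxp))
  · rw [Finset.filter_false_of_mem fun γ hγ hxγ => hx (h.image_subset_of_mem hγ hxγ),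
      if_neg fun hD => hx (hxv.1 hD.1)]
    rfl

end IsHeckeDatum

end EisensteinCount

section Eisenstein

variable {K : Type*} [Field K] {r : ℕ}

lemma rvPair_mulVec (x ω : Fin r → K) (γ : Matrix (Fin r) (Fin r) K) :
    rvPair x (γ.mulVec ω) = rvPair (Matrix.vecMul x γ) ω :=
  Matrix.dotProduct_mulVec x γ ω

lemma jfac_ne_zero {FF : Type*} [Field FF] {σ : FF →+* K} {Finf : Subfield K}
    (hσ : ∀ z, σ z ∈ Finf) {ξ : K} (hξ : ξ ≠ 0) (hr : 0 < r) (γ : GL (Fin r) FF) {ω : Fin r → K}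
    (hω : ω ∈ OmegaSet r hr Finf ξ) : jfac hr ξ (matOf σ γ) ω ≠ 0 := by
  refine mul_ne_zero (inv_ne_zero hξ) fun h => γ.det.ne_zero ?_
  refine Matrix.det_eq_zero_of_row_eq_zero (lastIdx r hr) fun j => σ.injective ?_
  rw [map_zero]
  exact congrFun (hω.1 (fun j => σ (γ.1 (lastIdx r hr) j)) (fun j => hσ _) h) j

end Eisenstein

section EisensteinSeries

variable {K : Type*} [NontriviallyNormedField K] {FF : Type*} [Field FF] {σ : FF →+* K} {r k : ℕ}

lemma eisF_eq_tsum_indicator (hk : k ≠ 0) (S : Set (Fin r → FF)) (ω : Fin r → K) :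
    EisF σ k S ω = ∑' x, S.indicator (fun x => (rvPair (fun i => σ (x i)) ω ^ k)⁻¹) x := by
  have h := tsum_subtype {x | x ∈ S ∧ x ≠ 0} fun x => (rvPair (fun i => σ (x i)) ω ^ k)⁻¹
  refine h.trans (tsum_congr fun x => ?_)
  by_cases hx : x = 0
  · have h0 (T : Set (Fin r → FF)) :
        T.indicator (fun x => (rvPair (fun i => σ (x i)) ω ^ k)⁻¹) x = 0 :=
      Set.indicator_apply_eq_zero.2 fun _ => by simp [hx, rvPair, hk]
    rw [h0, h0]
  · by_cases hS : x ∈ S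
    · rw [Set.indicator_of_mem (s := {x | x ∈ S ∧ x ≠ 0}) ⟨hS, hx⟩, Set.indicator_of_mem hS]
    · rw [Set.indicator_of_notMem (s := {x | x ∈ S ∧ x ≠ 0}) (mt And.left hS),
        Set.indicator_of_notMem hS]

lemma zpow_jfac_mul_eisF (hr : 0 < r) {ξ : K} (γ : GL (Fin r) FF) (hk : k ≠ 0)
    (S : Set (Fin r → FF)) {ω : Fin r → K} (hj : jfac hr ξ (matOf σ γ) ω ≠ 0) :
    jfac hr ξ (matOf σ γ) ω ^ (-(k : ℤ)) * EisF σ k S (actOmega hr ξ (matOf σ γ) ω) =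
      EisF σ k ((fun x => Matrix.vecMul x (γ : Matrix (Fin r) (Fin r) FF)) '' S) ω := by
  have h (x : Fin r → FF) : rvPair (fun i => σ (x i)) (actOmega hr ξ (matOf σ γ) ω) =
      (jfac hr ξ (matOf σ γ) ω)⁻¹ *
        rvPair (fun i => σ (Matrix.vecMul x (γ : Matrix (Fin r) (Fin r) FF) i)) ω := by
    have hx : (fun i => σ (Matrix.vecMul x (γ : Matrix (Fin r) (Fin r) FF) i)) =
        Matrix.vecMul (fun i => σ (x i)) (matOf σ γ) := by
      ext i
      exact RingHom.map_vecMul σ _ _ i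
    rw [hx, ← rvPair_mulVec, actOmega]
    exact dotProduct_smul _ _ _
  rw [eisF_eq_tsum_indicator hk, eisF_eq_tsum_indicator hk, ← tsum_mul_left,
    ← (rowAct FF γ).toEquiv.tsum_eq (Set.indicator (_ '' S) _)]
  refine tsum_congr fun x => ?_
  have hmem : rowAct FF γ x ∈ (fun x => Matrix.vecMul x (γ : Matrix (Fin r) (Fin r) FF)) '' S ↔
      x ∈ S := (rowAct FF γ).injective.mem_set_image
  change _ = Set.indicator _ (fun x => (rvPair (fun i => σ (x i)) ω ^ k)⁻¹) (rowAct FF γ x)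
  by_cases hx : x ∈ S
  · rw [Set.indicator_of_mem hx, Set.indicator_of_mem (hmem.2 hx), h, mul_pow, mul_inv, inv_pow,
      inv_inv, zpow_neg, zpow_natCast, inv_mul_cancel_left₀ (pow_ne_zero k hj)]
    rfl
  · rw [Set.indicator_of_notMem hx, Set.indicator_of_notMem (mt hmem.1 hx), mul_zero]

variable {Finf : Subfield K}

lemma exists_norm_le_mul_norm_rvPair [CompleteSpace K] (hFinf : IsClosed (Finf : Set K))
    (hnt : ∃ z ∈ Finf, 1 < ‖z‖) {ω : Fin r → K}
    (hω : ∀ x : Fin r → K, (∀ i, x i ∈ Finf) → rvPair x ω = 0 → x = 0) :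
    ∃ c : NNReal, ∀ x : Fin r → K, (∀ i, x i ∈ Finf) → ‖x‖ ≤ c * ‖rvPair x ω‖ := by
  let _ : NontriviallyNormedField Finf :=
    { (inferInstance : NormedField Finf) with
      non_trivial := let ⟨z, hz, h⟩ := hnt; ⟨⟨z, hz⟩, h⟩ }
  let _ : NormedSpace Finf K := { norm_smul_le a b := norm_mul_le (a : K) b }
  have : CompleteSpace Finf := hFinf.completeSpace_coe
  let φ : (Fin r → Finf) →ₗ[Finf] K :=
    { toFun x := rvPair (fun i => (x i : K)) ω
      map_add' x y := by simp [rvPair, add_mul, Finset.sum_add_distrib]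
      map_smul' a x := by simp [rvPair, Finset.mul_sum, mul_assoc, Subfield.smul_def] }
  obtain ⟨c, -, hc⟩ := φ.exists_antilipschitzWith <| LinearMap.ker_eq_bot'.2 fun x hx => by
    ext i
    exact congrFun (hω (fun i => (x i : K)) (fun i => (x i).2) hx) i
  refine ⟨c, fun x hx => ?_⟩
  have h := hc.le_mul_norm_sub (fun i => (⟨x i, hx i⟩ : Finf)) 0
  simp only [map_zero, add_zero, norm_neg] at h
  refine le_trans (le_of_eq ?_) h
  simp only [Pi.norm_def]
  rfl

lemma summable_indicator_cosetOf [IsUltrametricDist K] [CompleteSpace K]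
    (hFinf : IsClosed (Finf : Set K)) (hσ : ∀ z, σ z ∈ Finf) (hnt : ∃ z ∈ Finf, 1 < ‖z‖)
    (hk : k ≠ 0) {L : Set (Fin r → FF)}
    (hL : StronglyDiscrete ((fun x : Fin r → FF => fun i => σ (x i)) '' L)) (v : Fin r → FF)
    {ω : Fin r → K} (hω : ∀ x : Fin r → K, (∀ i, x i ∈ Finf) → rvPair x ω = 0 → x = 0) :
    Summable ((cosetOf v L).indicator fun x => (rvPair (fun i => σ (x i)) ω ^ k)⁻¹) := by
  obtain ⟨c, hc⟩ := exists_norm_le_mul_norm_rvPair hFinf hnt hω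
  rw [NonarchimedeanAddGroup.summable_iff_tendsto_cofinite_zero,
    Metric.tendsto_nhds]
  intro ε hε
  rw [Filter.eventually_cofinite]
  have hinj : Function.Injective (fun x : Fin r → FF => fun i => σ ((x - v) i)) := fun x y hxy =>
    sub_left_injective (funext fun i => σ.injective (congrFun hxy i))
  refine ((hL (Metric.closedBall 0 (c * max 1 ε⁻¹ + ‖fun i => σ (v i)‖))
    Metric.isBounded_closedBall).preimage hinj.injOn).subset fun x hx => ?_
  rw [Set.mem_ofPred_eq, dist_zero_right, not_lt] at hx
  have hxv : x ∈ cosetOf v L := by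
    by_contra hxv
    rw [Set.indicator_of_notMem hxv, norm_zero] at hx
    exact hx.not_gt hε
  rw [Set.indicator_of_mem hxv, norm_inv, norm_pow, le_inv_comm₀ hε] at hx
  · refine ⟨⟨x - v, hxv, rfl⟩, mem_closedBall_zero_iff.2 ?_⟩
    have h1 : ‖rvPair (fun i => σ (x i)) ω‖ ≤ max 1 ε⁻¹ := by
      refine le_max_iff.2 (or_iff_not_imp_left.2 fun h => ?_)
      exact (le_self_pow₀ (not_le.1 h).le hk).trans hx
    have h2 : (fun i => σ ((x - v) i)) = (fun i => σ (x i)) - fun i => σ (v i) := by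
      ext i
      exact map_sub σ _ _
    change ‖fun i => σ ((x - v) i)‖ ≤ _
    rw [h2]
    exact (norm_sub_le _ _).trans (add_le_add_left ((hc _ fun i => hσ _).trans (by gcongr)) _)
  · refine lt_of_not_ge fun h => ?_
    rw [← inv_nonpos] at h
    exact (hx.trans h).not_gt hε

lemma exists_one_lt_norm {A : Type*} [Ring A] [IsDomain A] [Infinite A] [Module A (Fin r → FF)]
    [Module.IsTorsionFree A (Fin r → FF)]
    {L : Submodule A (Fin r → FF)} (hL0 : L ≠ ⊥)
    (hL : StronglyDiscrete ((fun x : Fin r → FF => fun i => σ (x i)) '' L)) :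
    ∃ z : FF, 1 < ‖σ z‖ := by
  by_contra! h
  obtain ⟨y, hy, hy0⟩ := L.exists_mem_ne_zero_of_ne_bot hL0
  have hσi : Function.Injective (fun x : Fin r → FF => fun i => σ (x i)) := fun x y hxy =>
    funext fun i => σ.injective (congrFun hxy i)
  refine Set.infinite_range_of_injective (hσi.comp (smul_left_injective A hy0))
    ((hL (Metric.closedBall 0 1) Metric.isBounded_closedBall).subset ?_)
  rintro _ ⟨a, rfl⟩
  exact ⟨⟨a • y, L.smul_mem a hy, rfl⟩, mem_closedBall_zero_iff.2
    ((pi_norm_le_iff_of_nonneg zero_le_one).2 fun i => h _)⟩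

open Classical in
lemma sum_mul_tsum_indicator {ι X : Type*} (s : Finset ι) (c : ι → K) {T : ι → Set X} {H : X → K}
    (hT : ∀ i ∈ s, Summable ((T i).indicator H)) :
    ∑ i ∈ s, c i * ∑' x, (T i).indicator H x =
      ∑' x, (∑ i ∈ s, c i * if x ∈ T i then 1 else 0) * H x := by
  simp only [← tsum_mul_left]
  rw [← Summable.tsum_finsetSum fun i hi => (hT i hi).mul_left (c i)]
  refine tsum_congr fun x => ?_
  rw [Finset.sum_mul]
  refine Finset.sum_congr rfl fun i _ => ?_
  by_cases hx : x ∈ T i <;> simp [hx]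

end EisensteinSeries

/-- Theorem 14.7: the Hecke action on Eisenstein series. -/
theorem hecke_eisenstein_action
    (K : Type*) [NontriviallyNormedField K] [IsUltrametricDist K] [CompleteSpace K]
    [IsAlgClosed K]
    (Finf : Subfield K) (hFinfclosed : IsClosed (Finf : Set K))
    (hFinfloc : LocallyCompactSpace Finf)
    (ξ : K) (hξ : ξ ≠ 0)
    (Fq : Type*) [Field Fq] [Fintype Fq]
    (σ : RatFunc Fq →+* K) (hσ : ∀ z : RatFunc Fq, σ z ∈ Finf)
    (r k : ℕ) (hr : 2 ≤ r) (hk : 1 ≤ k)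
    (L L' : Submodule (Polynomial Fq) (Fin r → RatFunc Fq))
    (hLfg : L.FG) (hL'fg : L'.FG)
    (hLspan : Submodule.span (RatFunc Fq) (L : Set (Fin r → RatFunc Fq)) = ⊤)
    (hL'span : Submodule.span (RatFunc Fq) (L' : Set (Fin r → RatFunc Fq)) = ⊤)
    (hLdisc : StronglyDiscrete ((fun x : Fin r → RatFunc Fq => fun i => σ (x i)) ''
      (L : Set (Fin r → RatFunc Fq))))
    (hL'disc : StronglyDiscrete ((fun x : Fin r → RatFunc Fq => fun i => σ (x i)) ''
      (L' : Set (Fin r → RatFunc Fq))))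
    (v v' : Fin r → RatFunc Fq) (δ : GL (Fin r) (RatFunc Fq))
    -- (a): `vδ + L_pδ ⊆ v′ + L′_p`
    (hA : ∀ p : Ideal (Polynomial Fq), p.IsMaximal →
      (fun x => Matrix.vecMul x (δ : Matrix (Fin r) (Fin r) (RatFunc Fq))) ''
          cosetOf v (locSet (L : Set (Fin r → RatFunc Fq)) p) ⊆
        cosetOf v' (locSet (L' : Set (Fin r → RatFunc Fq)) p))
    -- (b): equality whenever `v ∉ L_p`
    (hB : ∀ p : Ideal (Polynomial Fq), p.IsMaximal →
      v ∉ locSet (L : Set (Fin r → RatFunc Fq)) p →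
      (fun x => Matrix.vecMul x (δ : Matrix (Fin r) (Fin r) (RatFunc Fq))) ''
          cosetOf v (locSet (L : Set (Fin r → RatFunc Fq)) p) =
        cosetOf v' (locSet (L' : Set (Fin r → RatFunc Fq)) p))
    -- (c): `L_pδ ⊄ pL′_p`
    (hC : ∀ p : Ideal (Polynomial Fq), p.IsMaximal →
      ¬ ((fun x => Matrix.vecMul x (δ : Matrix (Fin r) (Fin r) (RatFunc Fq))) ''
          locSet (L : Set (Fin r → RatFunc Fq)) p ⊆
        locSet ((p • L' : Submodule (Polynomial Fq) (Fin r → RatFunc Fq)) :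
          Set (Fin r → RatFunc Fq)) p))
    -- the elementary divisor exponents `μ_{p,1} ≥ … ≥ μ_{p,r} ≥ 0` of `L′_p/L_pδ`
    (μ : Ideal (Polynomial Fq) → Fin r → ℕ)
    (hμanti : ∀ p, Antitone (μ p))
    (hμdiv : ∀ p : Ideal (Polynomial Fq), p.IsMaximal →
      ∃ g : Polynomial Fq, p = Ideal.span {g} ∧
      ∃ e : Fin r → (Fin r → RatFunc Fq),
        locSet (L' : Set (Fin r → RatFunc Fq)) p = apSpan p e ∧
        (fun x => Matrix.vecMul x (δ : Matrix (Fin r) (Fin r) (RatFunc Fq))) ''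
            locSet (L : Set (Fin r → RatFunc Fq)) p =
          apSpan p (fun j => fun i => algebraMap (Polynomial Fq) (RatFunc Fq) (g ^ μ p j) * e j i))
    -- `R` is a set of representatives for `Γ_{v+L}∖Γ_{v+L}δΓ_{v′+L′}`
    (R : Finset (GL (Fin r) (RatFunc Fq)))
    (hcover : (⋃ γ ∈ R, {g : GL (Fin r) (RatFunc Fq) |
        ∃ c ∈ GammaSet v (L : Set (Fin r → RatFunc Fq)), g = c * γ}) =
      {g : GL (Fin r) (RatFunc Fq) | ∃ c ∈ GammaSet v (L : Set (Fin r → RatFunc Fq)),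
        ∃ c' ∈ GammaSet v' (L' : Set (Fin r → RatFunc Fq)), g = c * δ * c'})
    (hdisj : ∀ γ1 ∈ R, ∀ γ2 ∈ R,
      {g : GL (Fin r) (RatFunc Fq) |
          ∃ c ∈ GammaSet v (L : Set (Fin r → RatFunc Fq)), g = c * γ1} =
        {g : GL (Fin r) (RatFunc Fq) |
          ∃ c ∈ GammaSet v (L : Set (Fin r → RatFunc Fq)), g = c * γ2} →
      γ1 = γ2) :
    -- degenerate case: `μ_{p,1} ≥ μ_{p,r−1} + 2` for some `p`
    ((∃ p : Ideal (Polynomial Fq), p.IsMaximal ∧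
        μ p ⟨r - 2, by omega⟩ + 2 ≤ μ p ⟨0, by omega⟩) →
      ∀ ω ∈ OmegaSet r (by omega) Finf ξ,
        (∑ γ ∈ R, (jfac (by omega : 0 < r) ξ (matOf σ γ) ω) ^ (-(k : ℤ)) *
            EisF σ k (cosetOf v (L : Set (Fin r → RatFunc Fq)))
              (actOmega (by omega) ξ (matOf σ γ) ω)) = 0) ∧
    -- main case
    ((∀ p : Ideal (Polynomial Fq), p.IsMaximal →
        μ p ⟨0, by omega⟩ ≤ μ p ⟨r - 2, by omega⟩ + 1) →
      {p : Ideal (Polynomial Fq) | p.IsMaximal ∧ 2 ≤ μ p ⟨0, by omega⟩}.Finite ∧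
      (∃ v'' : Fin r → RatFunc Fq, v'' - v' ∈ L' ∧
        ∀ p ∈ {p : Ideal (Polynomial Fq) | p.IsMaximal ∧ 2 ≤ μ p ⟨0, by omega⟩},
          v'' ∈ locSet ((p • L' : Submodule (Polynomial Fq) (Fin r → RatFunc Fq)) :
            Set (Fin r → RatFunc Fq)) p) ∧
      ∀ (hS : {p : Ideal (Polynomial Fq) | p.IsMaximal ∧ 2 ≤ μ p ⟨0, by omega⟩}.Finite)
        (v'' : Fin r → RatFunc Fq), v'' - v' ∈ L' →
        (∀ p ∈ {p : Ideal (Polynomial Fq) | p.IsMaximal ∧ 2 ≤ μ p ⟨0, by omega⟩},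
          v'' ∈ locSet ((p • L' : Submodule (Polynomial Fq) (Fin r → RatFunc Fq)) :
            Set (Fin r → RatFunc Fq)) p) →
        ∀ ω ∈ OmegaSet r (by omega) Finf ξ,
          (∑ γ ∈ R, (jfac (by omega : 0 < r) ξ (matOf σ γ) ω) ^ (-(k : ℤ)) *
              EisF σ k (cosetOf v (L : Set (Fin r → RatFunc Fq)))
                (actOmega (by omega) ξ (matOf σ γ) ω)) =
            ∑ I ∈ hS.toFinset.powerset, (-1 : K) ^ I.card *
              EisF σ k (cosetOf v''
                (((∏ p ∈ I, p) • L' : Submodule (Polynomial Fq) (Fin r → RatFunc Fq)) :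
                  Set (Fin r → RatFunc Fq))) ω) := by
  classical
  obtain ⟨f, N, hN0, h⟩ := exists_isHeckeDatum hL'fg hLspan hA hB hcover hdisj
  obtain ⟨ℓ, hℓ⟩ := CharP.exists Fq
  have hℓp : Fact ℓ.Prime := ⟨(CharP.char_is_prime_or_zero Fq ℓ).resolve_right
    (CharP.char_ne_zero_of_finite Fq ℓ)⟩
  have hℓK : CharP K ℓ := charP_of_injective_ringHom
    (f := σ.comp ((algebraMap (Polynomial Fq) (RatFunc Fq)).comp Polynomial.C))
    (RingHom.injective _) ℓ
  have hk0 : k ≠ 0 := Nat.one_le_iff_ne_zero.1 hk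
  have hl (p j) : μ p j ≤ μ p ⟨0, by omega⟩ := hμanti p (Nat.zero_le j)
  have hlast (j : Fin r) : j ≤ lastIdx r (by omega) := Nat.le_pred_of_lt j.2
  have had (π : Polynomial Fq) (hπ : Prime π) :=
    exists_isAdapted_of_prime hlast hL'span hC hμanti hμdiv hπ
  have hnt : ∃ z ∈ Finf, 1 < ‖z‖ := by
    have hL'0 : L' ≠ ⊥ := by
      rintro rfl
      have : Nonempty (Fin r) := ⟨⟨0, by omega⟩⟩
      simp at hL'span
    have : Module.IsTorsionFree (Polynomial Fq) (RatFunc Fq) := inferInstance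
    have : Module.IsTorsionFree (Polynomial Fq) (Fin r → RatFunc Fq) := inferInstance
    obtain ⟨z, hz⟩ := exists_one_lt_norm hL'0 hL'disc
    exact ⟨σ z, hσ z, hz⟩
  have hsummable {ω : Fin r → K} (hω : ω ∈ OmegaSet r (by omega) Finf ξ)
      {T : Set (Fin r → RatFunc Fq)} (hT : T ⊆ cosetOf v' (L' : Set (Fin r → RatFunc Fq))) :
      Summable (T.indicator fun x => (rvPair (fun i => σ (x i)) ω ^ k)⁻¹) := by
    have := (summable_indicator_cosetOf hFinfclosed hσ hnt hk0 hL'disc v' hω.1).indicator T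
    rwa [Set.indicator_indicator, Set.inter_eq_left.2 hT] at this
  have hsum {ω : Fin r → K} (hω : ω ∈ OmegaSet r (by omega) Finf ξ) :
      (∑ γ ∈ R, (jfac (by omega : 0 < r) ξ (matOf σ γ) ω) ^ (-(k : ℤ)) *
        EisF σ k (cosetOf v (L : Set (Fin r → RatFunc Fq)))
          (actOmega (by omega) ξ (matOf σ γ) ω)) =
      ∑' x : Fin r → RatFunc Fq, ((R.filter fun γ : GL (Fin r) (RatFunc Fq) =>
        x ∈ (fun x => Matrix.vecMul x (γ : Matrix (Fin r) (Fin r) (RatFunc Fq))) ''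
          cosetOf v (L : Set (Fin r → RatFunc Fq))).card : K) *
            (rvPair (fun i => σ (x i)) ω ^ k)⁻¹ := by
    refine (Finset.sum_congr rfl fun γ _ => ?_).trans ((sum_mul_tsum_indicator R (fun _ => 1)
      fun γ hγ => hsummable hω (h.image_subset_of_mem hγ)).trans (tsum_congr fun x => ?_))
    · rw [zpow_jfac_mul_eisF _ _ hk0 _ (jfac_ne_zero hσ hξ _ γ hω), eisF_eq_tsum_indicator hk0,
        one_mul]
    · simp only [one_mul, Finset.sum_boole]
  refine ⟨fun ⟨p, hp, hμp⟩ ω hω => ?_, fun hμ => ⟨?_, ?_, fun hS v'' hv'' hv''S ω hω => ?_⟩⟩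
  · rw [hsum hω]
    refine (tsum_congr fun x => ?_).trans tsum_zero
    have hij : lastIdx r (by omega) ≠ ⟨r - 2, by omega⟩ := by
      rw [lastIdx, Ne, Fin.mk.injEq]
      omega
    rw [(CharP.natCast_eq_natCast K ℓ).2
      (h.card_modEq_zero hL'fg hL'span hN0 hl had hp hij hμp x), Nat.cast_zero, zero_mul]
  · exact h.finite_setOf_two_le hL'fg hN0 hl fun π hπ => (had π hπ).2
  · obtain ⟨v'', hv'', hv''p⟩ := h.exists_sub_mem
    refine ⟨v'', hv'', fun p ⟨hp, hμp⟩ => hv''p p hp ?_⟩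
    obtain ⟨π, -, rfl, hπN⟩ :=
      h.exists_prime_of_two_le hL'fg hN0 hl (fun π hπ => (had π hπ).2) hp hμp
    exact Ideal.mem_span_singleton.2 ((dvd_pow_self π two_ne_zero).trans hπN)
  · have hμ' (p : Ideal (Polynomial Fq)) (hp : p.IsMaximal) (j : Fin r)
        (hj : j ≠ lastIdx r (by omega)) : μ p ⟨0, by omega⟩ ≤ μ p j + 1 := by
      refine (hμ p hp).trans (Nat.add_le_add_right (hμanti p (Fin.le_def.2 ?_)) 1)
      rw [lastIdx, Ne, Fin.ext_iff] at hj
      have := j.2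
      change (j : ℕ) ≤ r - 2
      simp only at hj
      omega
    rw [hsum hω]
    simp only [eisF_eq_tsum_indicator hk0]
    rw [sum_mul_tsum_indicator _ _ fun I _ => hsummable hω <|
      (cosetOf_subset_iff).2 ⟨hv'', Submodule.smul_le_right⟩]
    refine tsum_congr fun x => ?_
    have := (CharP.intCast_eq_intCast K ℓ).2 (h.card_modEq_sum hr hL'fg hL'span hN0 hl had hμ'
      (S := hS.toFinset) (fun p => hS.mem_toFinset) hv''
      (fun p hp => hv''S p (hS.mem_toFinset.1 hp)) x)
    push_cast at this
    rw [this]
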